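/- arXiv:1212.0183 — 2 statements merged into one kernel-verified Lean document; each statement's English description precedes it below -/
import Mathlib

section
/- Let d ≥ 1 and 0 < α < 2. There exists a constant c₁ > 0 depending only on α and d such that for every q ∈ [1,∞], every ℤ^d-periodic, locally integrable function f : ℝ^d → ℝ with mean zero and ‖f‖_{L^q([0,1]^d)} < ∞, and every t > 0, one has ‖e^{-t|∇|^α} f‖_{L^q([0,1]^d)} ≤ e^{-c₁ t} ‖f‖_{L^q([0,1]^d)}. -/
open MeasureTheory
open scoped ENNReal

noncomputable section

/-- e^{2π i θ} -/
def fchar (θ : ℝ) : ℂ := Complex.exp (((2 * Real.pi * θ : ℝ) : ℂ) * Complex.I)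

/-- the fundamental cell [0,1]^d -/
def cube (d : ℕ) : Set (Fin d → ℝ) := Set.univ.pi fun _ => Set.Icc (0 : ℝ) 1

/-- periodic fractional heat kernel k_α^per(t,x) = ∑_{n ∈ ℤ^d} e^{-t(2π|n|)^α} e^{2πi n·x} -/
def kper (d : ℕ) (α t : ℝ) (x : Fin d → ℝ) : ℝ :=
  (∑' n : Fin d → ℤ,
      ((Real.exp (-t * (2 * Real.pi * Real.sqrt (∑ i, (n i : ℝ) ^ 2)) ^ α) : ℝ) : ℂ) *
        fchar (∑ i, (n i : ℝ) * x i)).re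

/-- The character `x ↦ e^{2πi n·x}` of the torus. -/
def torusChar {d : ℕ} (n : Fin d → ℤ) (x : Fin d → ℝ) : ℂ := fchar (∑ i, (n i : ℝ) * x i)

lemma fchar_add (a b : ℝ) : fchar (a + b) = fchar a * fchar b := by
  rw [fchar, fchar, fchar, ← Complex.exp_add]
  push_cast
  ring_nf

lemma fchar_zero : fchar 0 = 1 := by simp [fchar]

lemma norm_fchar (a : ℝ) : ‖fchar a‖ = 1 := Complex.norm_exp_ofReal_mul_I _

lemma fchar_neg (a : ℝ) : fchar (-a) = starRingEnd ℂ (fchar a) := by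
  rw [fchar, fchar, ← Complex.exp_conj, map_mul, Complex.conj_ofReal, Complex.conj_I]
  push_cast
  ring_nf

lemma continuous_fchar : Continuous fchar := by
  unfold fchar
  fun_prop

lemma fchar_sum {ι : Type*} (s : Finset ι) (g : ι → ℝ) :
    fchar (∑ i ∈ s, g i) = ∏ i ∈ s, fchar (g i) := by
  classical
  induction s using Finset.induction_on with
  | empty => simp [fchar_zero]
  | insert a s ha ih => rw [Finset.sum_insert ha, Finset.prod_insert ha, fchar_add, ih]

section torusChar

variable {d : ℕ}

lemma torusChar_zero (x : Fin d → ℝ) : torusChar 0 x = 1 := by simp [torusChar, fchar_zero]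

lemma norm_torusChar (n : Fin d → ℤ) (x : Fin d → ℝ) : ‖torusChar n x‖ = 1 := norm_fchar _

lemma torusChar_add (n : Fin d → ℤ) (x y : Fin d → ℝ) :
    torusChar n (x + y) = torusChar n x * torusChar n y := by
  rw [torusChar, torusChar, torusChar, ← fchar_add, ← Finset.sum_add_distrib]
  simp [mul_add]

lemma torusChar_neg (n : Fin d → ℤ) (x : Fin d → ℝ) :
    torusChar n (-x) = starRingEnd ℂ (torusChar n x) := by
  rw [torusChar, torusChar, ← fchar_neg, ← Finset.sum_neg_distrib]
  simp

lemma torusChar_sub_left (m n : Fin d → ℤ) (x : Fin d → ℝ) :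
    torusChar (m - n) x = torusChar m x * starRingEnd ℂ (torusChar n x) := by
  rw [torusChar, torusChar, torusChar, ← fchar_neg, ← fchar_add, ← Finset.sum_neg_distrib,
    ← Finset.sum_add_distrib]
  congr 1
  refine Finset.sum_congr rfl fun i _ => ?_
  simp only [Pi.sub_apply]
  push_cast
  ring

lemma continuous_torusChar (n : Fin d → ℤ) : Continuous (torusChar n) :=
  continuous_fchar.comp (by fun_prop)

lemma measurableSet_cube (d : ℕ) : MeasurableSet (cube d) :=
  MeasurableSet.univ_pi fun _ => measurableSet_Icc

lemma isCompact_cube (d : ℕ) : IsCompact (cube d) :=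
  isCompact_univ_pi fun _ => isCompact_Icc

lemma restrict_cube (d : ℕ) : (volume : Measure (Fin d → ℝ)).restrict (cube d) =
    Measure.pi fun _ : Fin d => (volume : Measure ℝ).restrict (Set.Icc 0 1) := by
  rw [cube, volume_pi, Measure.restrict_pi_pi]

instance isProbabilityMeasure_cube (d : ℕ) :
    IsProbabilityMeasure ((volume : Measure (Fin d → ℝ)).restrict (cube d)) :=
  ⟨by rw [restrict_cube, Measure.pi_univ]; simp⟩

lemma integral_fchar_int_mul (m : ℤ) :
    ∫ x in Set.Icc (0 : ℝ) 1, fchar (m * x) = if m = 0 then 1 else 0 := by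
  split_ifs with h
  · simp [h, fchar_zero]
  · rw [integral_Icc_eq_integral_Ioc, ← intervalIntegral.integral_of_le zero_le_one]
    have hc : (2 * Real.pi * m : ℂ) * Complex.I ≠ 0 := by
      simp [Real.pi_ne_zero, h]
    have := integral_exp_mul_complex (a := 0) (b := 1) hc
    have h1 : Complex.exp ((2 * Real.pi * m : ℂ) * Complex.I) = 1 := by
      rw [← Complex.exp_int_mul_two_pi_mul_I m]
      ring_nf
    simp only [Complex.ofReal_one, mul_one, h1, Complex.ofReal_zero, mul_zero, Complex.exp_zero,
      sub_self, zero_div] at this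
    rw [← this]
    refine intervalIntegral.integral_congr fun x _ => ?_
    simp only [fchar]
    push_cast
    ring_nf

lemma integral_cube_torusChar (n : Fin d → ℤ) :
    ∫ x in cube d, torusChar n x = if n = 0 then 1 else 0 := by
  simp only [torusChar, fchar_sum]
  rw [restrict_cube,
    integral_fintype_prod_eq_prod (fun i (x : ℝ) => fchar ((n i : ℝ) * x))]
  simp only [integral_fchar_int_mul]
  split_ifs with h
  · simp [h]
  · obtain ⟨i, hi⟩ := Function.ne_iff.mp h
    exact Finset.prod_eq_zero (Finset.mem_univ i) (if_neg hi)

lemma integral_cube_torusChar_add (n : Fin d → ℤ) (x : Fin d → ℝ) :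
    ∫ y in cube d, torusChar n (x + y) = if n = 0 then 1 else 0 := by
  simp only [torusChar_add, integral_const_mul, integral_cube_torusChar]
  split_ifs with h <;> simp [h, torusChar_zero]

lemma integral_cube_torusChar_sub (n : Fin d → ℤ) (x : Fin d → ℝ) :
    ∫ y in cube d, torusChar n (x - y) = if n = 0 then 1 else 0 := by
  simp only [sub_eq_add_neg, torusChar_add, torusChar_neg, integral_const_mul, integral_conj,
    integral_cube_torusChar]
  split_ifs with h <;> simp [h, torusChar_zero]

lemma integral_cube_torusChar_sub_left (n : Fin d → ℤ) (y : Fin d → ℝ) :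
    ∫ x in cube d, torusChar n (x - y) = if n = 0 then 1 else 0 := by
  simp only [sub_eq_add_neg, add_comm _ (-y), integral_cube_torusChar_add]

end torusChar

/-- A real Fourier multiplier on the torus which maps trigonometric polynomials with nonnegative
real part to trigonometric polynomials with nonnegative real part. -/
def IsPosMultiplier {d : ℕ} (p : (Fin d → ℤ) → ℝ) : Prop :=
  ∀ (ι : Type) (S : Finset ι) (ν : ι → Fin d → ℤ) (c : ι → ℂ),
    (∀ x, 0 ≤ (∑ i ∈ S, c i * torusChar (ν i) x).re) →
      ∀ x, 0 ≤ (∑ i ∈ S, (p (ν i) : ℂ) * (c i * torusChar (ν i) x)).re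

namespace IsPosMultiplier

variable {d : ℕ} {p q : (Fin d → ℤ) → ℝ}

lemma one : IsPosMultiplier (fun _ : Fin d → ℤ => (1 : ℝ)) := by
  intro ι S ν c h x
  simpa using h x

lemma zero : IsPosMultiplier (fun _ : Fin d → ℤ => (0 : ℝ)) := by
  intro ι S ν c h x
  simp

lemma add (hp : IsPosMultiplier p) (hq : IsPosMultiplier q) :
    IsPosMultiplier (fun n => p n + q n) := by
  intro ι S ν c h x
  simpa [add_mul, Finset.sum_add_distrib] using add_nonneg (hp ι S ν c h x) (hq ι S ν c h x)

lemma const_mul (hp : IsPosMultiplier p) {a : ℝ} (ha : 0 ≤ a) :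
    IsPosMultiplier (fun n => a * p n) := by
  intro ι S ν c h x
  have := mul_nonneg ha (hp ι S ν c h x)
  rw [← Complex.re_ofReal_mul, Finset.mul_sum] at this
  simpa only [Complex.ofReal_mul, mul_assoc] using this

lemma mul (hp : IsPosMultiplier p) (hq : IsPosMultiplier q) :
    IsPosMultiplier (fun n => p n * q n) := by
  intro ι S ν c h x
  have := hp ι S ν (fun i => q (ν i) * c i)
    (fun x => by simpa only [mul_assoc] using hq ι S ν c h x) x
  simpa only [Complex.ofReal_mul, mul_assoc] using this

lemma pow (hp : IsPosMultiplier p) (k : ℕ) : IsPosMultiplier (fun n => p n ^ k) := by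
  induction k with
  | zero => simpa only [pow_zero] using one
  | succ k ih => simpa only [pow_succ] using ih.mul hp

lemma sum {p : ℕ → (Fin d → ℤ) → ℝ} (hp : ∀ k, IsPosMultiplier (p k)) (N : ℕ) :
    IsPosMultiplier (fun n => ∑ k ∈ Finset.range N, p k n) := by
  induction N with
  | zero => simpa only [Finset.range_zero, Finset.sum_empty] using zero
  | succ N ih => simpa only [Finset.sum_range_succ] using ih.add (hp N)

lemma of_tendsto {P : ℕ → (Fin d → ℤ) → ℝ} (hP : ∀ k, IsPosMultiplier (P k))
    (h : ∀ n, Filter.Tendsto (fun k => P k n) Filter.atTop (nhds (p n))) :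
    IsPosMultiplier p := by
  intro ι S ν c hc x
  refine ge_of_tendsto' (x := Filter.atTop) ?_ fun k => hP k ι S ν c hc x
  refine (Complex.continuous_re.tendsto _).comp (tendsto_finsetSum _ fun i _ => ?_)
  exact ((Complex.continuous_ofReal.tendsto _).comp (h (ν i))).mul_const _

lemma exp (hp : IsPosMultiplier p) : IsPosMultiplier (fun n => Real.exp (p n)) := by
  refine of_tendsto (P := fun N n => ∑ k ∈ Finset.range N, ((k.factorial : ℝ)⁻¹ * p n ^ k))
    (sum fun k => IsPosMultiplier.const_mul (hp.pow k) (by positivity)) fun n => ?_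
  have := (NormedSpace.expSeries_div_hasSum_exp (p n)).tendsto_sum_nat
  rw [← Real.exp_eq_exp_ℝ] at this
  simpa only [div_eq_inv_mul] using this

end IsPosMultiplier

section heat

variable {d : ℕ}

/-- The eigenvalue `(2π|n|)²` of the negative Laplacian on the torus. -/
def laplaceEigenvalue (n : Fin d → ℤ) : ℝ := 4 * Real.pi ^ 2 * ∑ i, (n i : ℝ) ^ 2

lemma laplaceEigenvalue_nonneg (n : Fin d → ℤ) : 0 ≤ laplaceEigenvalue n :=
  mul_nonneg (by positivity) (Finset.sum_nonneg fun _ _ => sq_nonneg _)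

lemma laplaceEigenvalue_zero : laplaceEigenvalue (0 : Fin d → ℤ) = 0 := by
  simp [laplaceEigenvalue]

/-- The unnormalized Gaussian `e^{-|y|²/(4s)}`. -/
def gaussianWeight (s : ℝ) (y : Fin d → ℝ) : ℝ := Real.exp (-(1 / (4 * s)) * ∑ i, y i ^ 2)

lemma gaussianWeight_mul_torusChar (s : ℝ) (n : Fin d → ℤ) (y : Fin d → ℝ) :
    (gaussianWeight s y : ℂ) * torusChar n y =
      Complex.exp (-((1 / (4 * s) : ℝ) : ℂ) * ∑ i, (y i : ℂ) ^ 2 +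
        ∑ i, (2 * Real.pi * n i * Complex.I : ℂ) * y i) := by
  rw [gaussianWeight, torusChar, fchar, Complex.exp_add, Complex.ofReal_exp]
  congr 2
  · push_cast
    ring
  · push_cast
    rw [Finset.mul_sum, Finset.sum_mul]
    exact Finset.sum_congr rfl fun i _ => by ring

lemma integrable_gaussianWeight_mul_torusChar {s : ℝ} (hs : 0 < s) (n : Fin d → ℤ) :
    Integrable (fun y : Fin d → ℝ => (gaussianWeight s y : ℂ) * torusChar n y) := by
  simp only [gaussianWeight_mul_torusChar]
  exact GaussianFourier.integrable_cexp_neg_mul_sum_add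
    (by rw [Complex.ofReal_re]; positivity) _

lemma integral_gaussianWeight_mul_torusChar {s : ℝ} (hs : 0 < s) (n : Fin d → ℤ) :
    ∫ y : Fin d → ℝ, (gaussianWeight s y : ℂ) * torusChar n y =
      (((4 * Real.pi * s) ^ (d / 2 : ℝ) * Real.exp (-s * laplaceEigenvalue n) : ℝ) : ℂ) := by
  have hb : 0 < ((1 / (4 * s) : ℝ) : ℂ).re := by rw [Complex.ofReal_re]; positivity
  have hs' : (s : ℂ) ≠ 0 := by exact_mod_cast hs.ne'
  simp only [gaussianWeight_mul_torusChar]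
  rw [GaussianFourier.integral_cexp_neg_mul_sum_add hb, Complex.ofReal_mul,
    Complex.ofReal_cpow (by positivity), Complex.ofReal_exp, Fintype.card_fin]
  congr 2
  · push_cast
    field_simp
  · push_cast
    rfl
  · simp only [mul_pow, Complex.I_sq, laplaceEigenvalue]
    push_cast
    rw [← Finset.sum_mul, ← Finset.mul_sum]
    field_simp
    ring

variable {ι : Type} (S : Finset ι) (ν : ι → Fin d → ℤ) (c : ι → ℂ)

lemma continuous_trigSum : Continuous fun x => ∑ i ∈ S, c i * torusChar (ν i) x :=
  continuous_finsetSum _ fun _ _ => continuous_const.mul (continuous_torusChar _)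

lemma gaussianWeight_pos (s : ℝ) (y : Fin d → ℝ) : 0 < gaussianWeight s y := Real.exp_pos _

lemma hasIntegral_gaussian_trigSum {s : ℝ} (hs : 0 < s) (x : Fin d → ℝ) :
    Integrable (fun y => gaussianWeight s y * (∑ i ∈ S, c i * torusChar (ν i) (x + y)).re) ∧
    ∫ y, gaussianWeight s y * (∑ i ∈ S, c i * torusChar (ν i) (x + y)).re =
      (4 * Real.pi * s) ^ (d / 2 : ℝ) *
        (∑ i ∈ S, (Real.exp (-s * laplaceEigenvalue (ν i)) : ℂ) *
          (c i * torusChar (ν i) x)).re := by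
  have hF : ∀ y, gaussianWeight s y * (∑ i ∈ S, c i * torusChar (ν i) (x + y)).re =
      (∑ i ∈ S, (c i * torusChar (ν i) x) * ((gaussianWeight s y : ℂ) * torusChar (ν i) y)).re := by
    intro y
    rw [← Complex.re_ofReal_mul, Finset.mul_sum]
    congr 1
    refine Finset.sum_congr rfl fun i _ => ?_
    rw [torusChar_add]
    ring
  have hint : Integrable (fun y => ∑ i ∈ S,
      (c i * torusChar (ν i) x) * ((gaussianWeight s y : ℂ) * torusChar (ν i) y)) :=
    integrable_finsetSum _ fun i _ => (integrable_gaussianWeight_mul_torusChar hs _).const_mul _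
  simp only [hF]
  refine ⟨hint.re, ?_⟩
  have := Complex.reCLM.integral_comp_comm hint
  simp only [Complex.reCLM_apply] at this
  rw [this, integral_finsetSum _
    fun i _ => (integrable_gaussianWeight_mul_torusChar hs _).const_mul _,
    ← Complex.re_ofReal_mul, Finset.mul_sum]
  congr 1
  refine Finset.sum_congr rfl fun i _ => ?_
  rw [integral_const_mul, integral_gaussianWeight_mul_torusChar hs]
  push_cast
  ring

lemma integral_cube_trigSum (x : Fin d → ℝ) :
    ∫ y in cube d, (∑ i ∈ S, c i * torusChar (ν i) (x + y)).re =
      (∑ i ∈ S, ((if ν i = 0 then 1 else 0 : ℝ) : ℂ) * (c i * torusChar (ν i) x)).re := by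
  have hi : ∀ i ∈ S, Integrable (fun y => c i * torusChar (ν i) (x + y))
      (volume.restrict (cube d)) := fun i _ =>
    ((continuous_const.mul ((continuous_torusChar _).comp (by fun_prop))).continuousOn
      (s := cube d)).integrableOn_compact (isCompact_cube d)
  have := Complex.reCLM.integral_comp_comm (integrable_finsetSum _ hi)
  simp only [Complex.reCLM_apply] at this
  rw [this, integral_finsetSum _ hi]
  congr 1
  refine Finset.sum_congr rfl fun i _ => ?_
  rw [integral_const_mul, integral_cube_torusChar_add]
  split_ifs with h <;> simp [h, torusChar_zero]

lemma isPosMultiplier_heat {s : ℝ} (hs : 0 < s) :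
    IsPosMultiplier (fun n : Fin d → ℤ => Real.exp (-s * laplaceEigenvalue n)) := by
  intro ι S ν c h x
  have := (hasIntegral_gaussian_trigSum S ν c hs x).2
  have h0 : 0 ≤ ∫ y, gaussianWeight s y * (∑ i ∈ S, c i * torusChar (ν i) (x + y)).re :=
    integral_nonneg fun y => mul_nonneg (gaussianWeight_pos _ _).le (h _)
  rw [this] at h0
  exact nonneg_of_mul_nonneg_right h0 (by positivity)

/-- A lower bound of the Gaussian heat kernel on the unit cube for times in `[1, 2]`. -/
def heatLowerBound (d : ℕ) : ℝ := (8 * Real.pi) ^ (-(d / 2 : ℝ)) * Real.exp (-(d / 4 : ℝ))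

lemma heatLowerBound_pos (d : ℕ) : 0 < heatLowerBound d := by
  unfold heatLowerBound
  positivity

lemma exp_neg_le_gaussianWeight {s : ℝ} (hs : 1 ≤ s) {y : Fin d → ℝ} (hy : y ∈ cube d) :
    Real.exp (-(d / 4 : ℝ)) ≤ gaussianWeight s y := by
  have hy' : ∀ i, 0 ≤ y i ∧ y i ≤ 1 := fun i => hy i (Set.mem_univ i)
  have h1 : ∑ i, y i ^ 2 ≤ d := by
    calc ∑ i, y i ^ 2 ≤ ∑ _i : Fin d, (1 : ℝ) :=
          Finset.sum_le_sum fun i _ => pow_le_one₀ (hy' i).1 (hy' i).2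
      _ = d := by simp
  have h2 : 1 / (4 * s) ≤ 1 / 4 := by
    apply one_div_le_one_div_of_le <;> linarith
  have h3 : 0 ≤ ∑ i, y i ^ 2 := Finset.sum_nonneg fun _ _ => sq_nonneg _
  refine Real.exp_le_exp.mpr ?_
  have := mul_le_mul h2 h1 h3 (by norm_num)
  linarith

lemma isPosMultiplier_heat_sub {s : ℝ} (hs1 : 1 ≤ s) (hs2 : s ≤ 2) :
    IsPosMultiplier (fun n : Fin d → ℤ => Real.exp (-s * laplaceEigenvalue n) +
      -heatLowerBound d * if n = 0 then 1 else 0) := by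
  intro ι S ν c h x
  have hs : 0 < s := by linarith
  obtain ⟨hint, heq⟩ := hasIntegral_gaussian_trigSum S ν c hs x
  have hcube := integral_cube_trigSum S ν c x
  set T : (Fin d → ℝ) → ℝ := fun y => (∑ i ∈ S, c i * torusChar (ν i) (x + y)).re with hT
  have hTc : Continuous T :=
    Complex.continuous_re.comp ((continuous_trigSum S ν c).comp (by fun_prop))
  have hT0 : ∀ y, 0 ≤ T y := fun y => h _
  set H := (∑ i ∈ S, (Real.exp (-s * laplaceEigenvalue (ν i)) : ℂ) *
          (c i * torusChar (ν i) x)).re with hH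
  have hle : Real.exp (-(d / 4 : ℝ)) * ∫ y in cube d, T y ≤ (4 * Real.pi * s) ^ (d / 2 : ℝ) * H := by
    rw [← heq, ← integral_const_mul]
    calc ∫ y in cube d, Real.exp (-(d / 4 : ℝ)) * T y
        ≤ ∫ y in cube d, gaussianWeight s y * T y := by
          refine setIntegral_mono_on ?_ hint.integrableOn (measurableSet_cube d) fun y hy =>
            mul_le_mul_of_nonneg_right (exp_neg_le_gaussianWeight hs1 hy) (hT0 y)
          exact (continuous_const.mul hTc).continuousOn.integrableOn_compact (isCompact_cube d)
      _ ≤ ∫ y, gaussianWeight s y * T y :=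
          setIntegral_le_integral hint
            (Filter.Eventually.of_forall fun y => mul_nonneg (gaussianWeight_pos _ _).le (hT0 y))
  have hI0 : 0 ≤ ∫ y in cube d, T y := integral_nonneg hT0
  have hHn : 0 ≤ H := isPosMultiplier_heat hs ι S ν c h x
  have hle2 : heatLowerBound d * ∫ y in cube d, T y ≤ H := by
    rw [heatLowerBound, Real.rpow_neg (by positivity), mul_assoc, inv_mul_le_iff₀ (by positivity)]
    refine hle.trans (mul_le_mul_of_nonneg_right ?_ hHn)
    refine Real.rpow_le_rpow (by positivity) ?_ (by positivity)
    nlinarith [Real.pi_pos]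
  rw [hcube] at hle2
  have : (∑ i ∈ S, (((Real.exp (-s * laplaceEigenvalue (ν i)) +
      -heatLowerBound d * if ν i = 0 then 1 else 0 : ℝ)) : ℂ) * (c i * torusChar (ν i) x)).re =
      H - heatLowerBound d * (∑ i ∈ S, ((if ν i = 0 then 1 else 0 : ℝ) : ℂ) *
        (c i * torusChar (ν i) x)).re := by
    rw [hH, ← Complex.re_ofReal_mul, ← Complex.sub_re, Finset.mul_sum, ← Finset.sum_sub_distrib]
    congr 1
    refine Finset.sum_congr rfl fun i _ => ?_
    push_cast
    ring
  rw [this]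
  linarith

end heat

section subordination

variable {β : ℝ}

lemma integrableOn_subordination (hβ0 : 0 < β) (hβ1 : β < 1) {l : ℝ} (hl : 0 ≤ l) :
    IntegrableOn (fun s => (1 - Real.exp (-s * l)) * s ^ (-1 - β)) (Set.Ioi 0) := by
  have hm : Measurable fun s : ℝ => (1 - Real.exp (-s * l)) * s ^ (-1 - β) := by fun_prop
  have hnn : ∀ s : ℝ, 0 < s → 0 ≤ 1 - Real.exp (-s * l) := fun s hs => by
    have : Real.exp (-s * l) ≤ 1 := Real.exp_le_one_iff.mpr (by nlinarith)
    linarith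
  rw [← Set.Ioc_union_Ioi_eq_Ioi zero_le_one]
  refine IntegrableOn.union ?_ ?_
  · have h1 : IntegrableOn (fun s : ℝ => l * s ^ (-β)) (Set.Ioc 0 1) :=
      ((intervalIntegral.intervalIntegrable_rpow' (a := 0) (b := 1) (r := -β)
        (by linarith)).1).const_mul l
    refine h1.mono' hm.aestronglyMeasurable ?_
    refine (ae_restrict_iff' measurableSet_Ioc).mpr (Filter.Eventually.of_forall fun s hs => ?_)
    rw [Real.norm_of_nonneg (mul_nonneg (hnn s hs.1) (Real.rpow_nonneg hs.1.le _))]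
    have h2 : s ^ (-β) = s * s ^ (-1 - β) := by
      rw [← Real.rpow_one_add' hs.1.le (by linarith)]
      ring_nf
    rw [h2, ← mul_assoc]
    refine mul_le_mul_of_nonneg_right ?_ (Real.rpow_nonneg hs.1.le _)
    have := Real.add_one_le_exp (-s * l)
    linarith
  · refine (integrableOn_Ioi_rpow_of_lt (a := -1 - β) (by linarith) one_pos).mono'
      hm.aestronglyMeasurable ?_
    refine (ae_restrict_iff' measurableSet_Ioi).mpr (Filter.Eventually.of_forall fun s hs => ?_)
    have hs0 : (0 : ℝ) < s := one_pos.trans hs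
    rw [Real.norm_of_nonneg (mul_nonneg (hnn s hs0) (Real.rpow_nonneg hs0.le _))]
    refine mul_le_of_le_one_left (Real.rpow_nonneg hs0.le _) ?_
    linarith [Real.exp_pos (-s * l)]

/-- The constant in the subordination formula for `λ ↦ λ^β`. -/
def subordinationConst (β : ℝ) : ℝ := ∫ s in Set.Ioi 0, (1 - Real.exp (-s)) * s ^ (-1 - β)

lemma subordinationConst_pos (hβ0 : 0 < β) (hβ1 : β < 1) : 0 < subordinationConst β := by
  have hint := integrableOn_subordination hβ0 hβ1 zero_le_one
  simp only [mul_one] at hint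
  have hpos : ∀ s ∈ Set.Ioi (0 : ℝ), 0 < (1 - Real.exp (-s)) * s ^ (-1 - β) := fun s hs =>
    mul_pos (sub_pos.mpr (by simpa using hs)) (Real.rpow_pos_of_pos hs _)
  rw [subordinationConst, setIntegral_pos_iff_support_of_nonneg_ae
    ((ae_restrict_iff' measurableSet_Ioi).mpr
      (Filter.Eventually.of_forall fun s hs => (hpos s hs).le)) hint]
  rw [Set.inter_eq_right.mpr fun s hs => Function.mem_support.mpr (hpos s hs).ne']
  simp

lemma integral_subordination (hβ0 : 0 < β) {l : ℝ} (hl : 0 ≤ l) :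
    ∫ s in Set.Ioi 0, (1 - Real.exp (-s * l)) * s ^ (-1 - β) = subordinationConst β * l ^ β := by
  rcases hl.eq_or_lt with rfl | hl
  · simp [Real.zero_rpow hβ0.ne']
  · have h := integral_comp_mul_left_Ioi
      (fun u => (1 - Real.exp (-u)) * u ^ (-1 - β)) 0 hl
    rw [mul_zero, smul_eq_mul] at h
    have h2 : ∫ s in Set.Ioi 0, (1 - Real.exp (-(l * s))) * (l * s) ^ (-1 - β) =
        l ^ (-1 - β) * ∫ s in Set.Ioi 0, (1 - Real.exp (-s * l)) * s ^ (-1 - β) := by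
      rw [← integral_const_mul]
      refine setIntegral_congr_fun measurableSet_Ioi fun s hs => ?_
      rw [Real.mul_rpow hl.le (le_of_lt hs)]
      ring_nf
    rw [h2] at h
    have h3 : l ^ (1 + β) * l ^ (-1 - β) = 1 := by
      rw [← Real.rpow_add hl]
      simp
    have h4 : l ^ (1 + β) = l * l ^ β := by rw [Real.rpow_add hl, Real.rpow_one]
    calc _ = l ^ (1 + β) * (l ^ (-1 - β) *
          ∫ s in Set.Ioi 0, (1 - Real.exp (-s * l)) * s ^ (-1 - β)) := by
          rw [← mul_assoc, h3, one_mul]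
      _ = _ := by
          rw [h, h4, subordinationConst]
          field_simp

/-- The Laplace transform of the measure `s^{-1-β} ds` restricted to `(1/(k+1), ∞)`. -/
def truncatedLaplace (β : ℝ) (k : ℕ) (l : ℝ) : ℝ :=
  ∫ s in Set.Ioi (1 / ((k : ℝ) + 1)), Real.exp (-s * l) * s ^ (-1 - β)

lemma integrableOn_truncatedLaplace (hβ0 : 0 < β) (k : ℕ) {l : ℝ} (hl : 0 ≤ l) :
    IntegrableOn (fun s => Real.exp (-s * l) * s ^ (-1 - β)) (Set.Ioi (1 / ((k : ℝ) + 1))) := by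
  have hk : (0 : ℝ) < 1 / ((k : ℝ) + 1) := by positivity
  refine (integrableOn_Ioi_rpow_of_lt (a := -1 - β) (by linarith) hk).mono'
    (by fun_prop : Measurable _).aestronglyMeasurable ?_
  refine (ae_restrict_iff' measurableSet_Ioi).mpr (Filter.Eventually.of_forall fun s hs => ?_)
  have hs0 : (0 : ℝ) < s := hk.trans hs
  rw [Real.norm_of_nonneg (mul_nonneg (Real.exp_pos _).le (Real.rpow_nonneg hs0.le _))]
  exact mul_le_of_le_one_left (Real.rpow_nonneg hs0.le _)
    (Real.exp_le_one_iff.mpr (by nlinarith))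

lemma tendsto_truncatedLaplace (hβ0 : 0 < β) (hβ1 : β < 1) {l : ℝ} (hl : 0 ≤ l) :
    Filter.Tendsto (fun k => truncatedLaplace β k 0 - truncatedLaplace β k l) Filter.atTop
      (nhds (subordinationConst β * l ^ β)) := by
  have hU : ⋃ k : ℕ, Set.Ioi (1 / ((k : ℝ) + 1)) = Set.Ioi 0 := by
    ext s
    simp only [Set.mem_iUnion, Set.mem_Ioi]
    refine ⟨fun ⟨k, hk⟩ => lt_trans (by positivity) hk, fun hs => exists_nat_one_div_lt hs⟩
  have h := tendsto_setIntegral_of_monotone (μ := volume)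
    (f := fun s => (1 - Real.exp (-s * l)) * s ^ (-1 - β))
    (s := fun k : ℕ => Set.Ioi (1 / ((k : ℝ) + 1))) (fun _ => measurableSet_Ioi)
    (fun k m hkm => Set.Ioi_subset_Ioi (Nat.one_div_le_one_div hkm))
    (by rw [hU]; exact integrableOn_subordination hβ0 hβ1 hl)
  rw [hU, integral_subordination hβ0 hl] at h
  refine h.congr fun k => ?_
  rw [truncatedLaplace, truncatedLaplace, ← integral_sub
    (integrableOn_truncatedLaplace hβ0 k le_rfl) (integrableOn_truncatedLaplace hβ0 k hl)]
  simp only [mul_zero, Real.exp_zero, sub_mul]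

/-- The total mass of the part of the Lévy measure which is bounded below by Lebesgue measure. -/
def levyLowerBound (d : ℕ) (β : ℝ) : ℝ :=
  heatLowerBound d * ∫ s in Set.Ioc (1 : ℝ) 2, s ^ (-1 - β)

lemma integrableOn_rpow_Ioc_one_two (r : ℝ) : IntegrableOn (fun s : ℝ => s ^ r) (Set.Ioc 1 2) := by
  refine IntegrableOn.mono_set (ContinuousOn.integrableOn_Icc (a := 1) (b := 2) ?_)
    Set.Ioc_subset_Icc_self
  exact continuousOn_id.rpow_const fun s hs => Or.inl (by simp only [id]; linarith [hs.1])

lemma levyLowerBound_pos (d : ℕ) (β : ℝ) : 0 < levyLowerBound d β := by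
  refine mul_pos (heatLowerBound_pos d) ?_
  have hpos : ∀ s ∈ Set.Ioc (1 : ℝ) 2, 0 < s ^ (-1 - β) := fun s hs =>
    Real.rpow_pos_of_pos (by linarith [hs.1]) _
  rw [setIntegral_pos_iff_support_of_nonneg_ae
    ((ae_restrict_iff' measurableSet_Ioc).mpr
      (Filter.Eventually.of_forall fun s hs => (hpos s hs).le)) (integrableOn_rpow_Ioc_one_two _)]
  rw [Set.inter_eq_right.mpr fun s hs => Function.mem_support.mpr (hpos s hs).ne']
  simp

lemma isPosMultiplier_truncatedLaplace {d : ℕ} (hβ0 : 0 < β) (k : ℕ) :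
    IsPosMultiplier (fun n : Fin d → ℤ => truncatedLaplace β k (laplaceEigenvalue n) +
      -levyLowerBound d β * if n = 0 then 1 else 0) := by
  intro ι S ν c h x
  set C₀ := (∑ i ∈ S, ((if ν i = 0 then 1 else 0 : ℝ) : ℂ) * (c i * torusChar (ν i) x)).re with hC₀
  set H : ℝ → ℝ := fun s => (∑ i ∈ S, (Real.exp (-s * laplaceEigenvalue (ν i)) : ℂ) *
          (c i * torusChar (ν i) x)).re with hH
  have hH0 : ∀ s, 0 < s → 0 ≤ H s := fun s hs => isPosMultiplier_heat hs ι S ν c h x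
  have hH1 : ∀ s ∈ Set.Ioc (1 : ℝ) 2, heatLowerBound d * C₀ ≤ H s := fun s hs => by
    have := isPosMultiplier_heat_sub hs.1.le hs.2 ι S ν c h x
    have e : (∑ i ∈ S, (((Real.exp (-s * laplaceEigenvalue (ν i)) +
        -heatLowerBound d * if ν i = 0 then 1 else 0 : ℝ)) : ℂ) * (c i * torusChar (ν i) x)).re =
        H s - heatLowerBound d * C₀ := by
      simp only [hH, hC₀]
      rw [← Complex.re_ofReal_mul, ← Complex.sub_re, Finset.mul_sum, ← Finset.sum_sub_distrib]
      congr 1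
      refine Finset.sum_congr rfl fun i _ => ?_
      push_cast
      ring
    linarith
  have hk : (0 : ℝ) < 1 / ((k : ℝ) + 1) := by positivity
  have hk1 : 1 / ((k : ℝ) + 1) ≤ 1 := by
    rw [div_le_one (by positivity)]
    linarith [k.cast_nonneg (α := ℝ)]
  have hHs : ∀ s, H s * s ^ (-1 - β) = ∑ i ∈ S, (c i * torusChar (ν i) x).re *
      (Real.exp (-s * laplaceEigenvalue (ν i)) * s ^ (-1 - β)) := fun s => by
    simp only [hH, Complex.re_sum, Complex.re_ofReal_mul, Finset.sum_mul]
    exact Finset.sum_congr rfl fun i _ => by ring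
  have hi : ∀ i ∈ S, IntegrableOn (fun s => (c i * torusChar (ν i) x).re *
      (Real.exp (-s * laplaceEigenvalue (ν i)) * s ^ (-1 - β))) (Set.Ioi (1 / ((k : ℝ) + 1))) :=
    fun i _ => (integrableOn_truncatedLaplace hβ0 k (laplaceEigenvalue_nonneg _)).const_mul _
  have hint : IntegrableOn (fun s => H s * s ^ (-1 - β)) (Set.Ioi (1 / ((k : ℝ) + 1))) := by
    simp only [hHs]
    exact integrable_finsetSum _ hi
  have hsub : Set.Ioc (1 : ℝ) 2 ⊆ Set.Ioi (1 / ((k : ℝ) + 1)) := fun s hs => hk1.trans_lt hs.1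
  have hval : ∫ s in Set.Ioi (1 / ((k : ℝ) + 1)), H s * s ^ (-1 - β) =
      (∑ i ∈ S, (truncatedLaplace β k (laplaceEigenvalue (ν i)) : ℂ) *
        (c i * torusChar (ν i) x)).re := by
    simp only [hHs]
    rw [integral_finsetSum _ hi, Complex.re_sum]
    refine Finset.sum_congr rfl fun i _ => ?_
    rw [integral_const_mul, Complex.re_ofReal_mul, truncatedLaplace, mul_comm]
  have hle : levyLowerBound d β * C₀ ≤ ∫ s in Set.Ioi (1 / ((k : ℝ) + 1)), H s * s ^ (-1 - β) := by
    calc levyLowerBound d β * C₀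
        = ∫ s in Set.Ioc (1 : ℝ) 2, heatLowerBound d * C₀ * s ^ (-1 - β) := by
          rw [integral_const_mul, levyLowerBound]
          ring
      _ ≤ ∫ s in Set.Ioc (1 : ℝ) 2, H s * s ^ (-1 - β) :=
          setIntegral_mono_on ((integrableOn_rpow_Ioc_one_two _).const_mul _)
            (hint.mono_set hsub) measurableSet_Ioc fun s hs =>
            mul_le_mul_of_nonneg_right (hH1 s hs) (Real.rpow_nonneg (by linarith [hs.1]) _)
      _ ≤ _ := by
          refine setIntegral_mono_set hint ?_ hsub.eventuallyLE
          refine (ae_restrict_iff' measurableSet_Ioi).mpr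
            (Filter.Eventually.of_forall fun s hs => ?_)
          exact mul_nonneg (hH0 s (hk.trans hs)) (Real.rpow_nonneg (hk.trans hs).le _)
  rw [hval] at hle
  have e : (∑ i ∈ S, (((truncatedLaplace β k (laplaceEigenvalue (ν i)) +
      -levyLowerBound d β * if ν i = 0 then 1 else 0 : ℝ)) : ℂ) * (c i * torusChar (ν i) x)).re =
      (∑ i ∈ S, (truncatedLaplace β k (laplaceEigenvalue (ν i)) : ℂ) *
        (c i * torusChar (ν i) x)).re - levyLowerBound d β * C₀ := by
    rw [hC₀, ← Complex.re_ofReal_mul, ← Complex.sub_re, Finset.mul_sum, ← Finset.sum_sub_distrib]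
    congr 1
    refine Finset.sum_congr rfl fun i _ => ?_
    push_cast
    ring
  rw [e]
  linarith

/-- The decay rate of the fractional heat flow on mean zero functions. -/
def decayRate (d : ℕ) (β : ℝ) : ℝ := levyLowerBound d β / subordinationConst β

lemma isPosMultiplier_fractionalHeat {d : ℕ} (hβ0 : 0 < β) (hβ1 : β < 1) {t : ℝ} (ht : 0 < t) :
    IsPosMultiplier (fun n : Fin d → ℤ => Real.exp (-t * laplaceEigenvalue n ^ β +
      decayRate d β * t * (1 - if n = 0 then 1 else 0))) := by
  have hC := subordinationConst_pos hβ0 hβ1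
  set C := subordinationConst β with hCdef
  set a := levyLowerBound d β with ha
  refine IsPosMultiplier.of_tendsto (P := fun k n =>
    Real.exp (t / C * (a - truncatedLaplace β k 0)) * Real.exp (t / C *
      (truncatedLaplace β k (laplaceEigenvalue n) + -a * if n = 0 then 1 else 0)))
    (fun k => IsPosMultiplier.const_mul (IsPosMultiplier.exp (IsPosMultiplier.const_mul
      (isPosMultiplier_truncatedLaplace hβ0 k) (by positivity))) (Real.exp_pos _).le) fun n => ?_
  simp only [← Real.exp_add]
  refine (Real.continuous_exp.tendsto _).comp ?_
  have h := (((tendsto_truncatedLaplace hβ0 hβ1 (laplaceEigenvalue_nonneg n)).neg.add_const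
    (a * (1 - if n = 0 then 1 else 0))).const_mul (t / C))
  convert h using 2
  · ring
  · simp only [decayRate, ← hCdef, ← ha]
    field_simp

end subordination

section fejer

variable {d : ℕ}

lemma tsum_ite_sub_mem (F : Finset (Fin d → ℤ)) (m : Fin d → ℤ) (g : (Fin d → ℤ) → ℂ) :
    ∑' n, (if m - n ∈ F then g n else 0) = ∑ m' ∈ F, g (m - m') := by
  rw [← (Equiv.subLeft m).tsum_eq, tsum_eq_sum (s := F)]
  · exact Finset.sum_congr rfl fun m' hm' => by simp [hm']
  · intro m' hm'
    simp [hm']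

lemma sum_sum_sub_eq_tsum (F : Finset (Fin d → ℤ)) (g : (Fin d → ℤ) → ℂ) (hg : Summable g) :
    ∑ m ∈ F, ∑ m' ∈ F, g (m - m') = ∑' n, ((F.filter fun m => m - n ∈ F).card : ℂ) * g n := by
  simp only [← tsum_ite_sub_mem]
  rw [← Summable.tsum_finsetSum]
  · refine tsum_congr fun n => ?_
    rw [Finset.sum_ite, Finset.sum_const_zero, add_zero, Finset.sum_const, nsmul_eq_mul]
  · intro m _
    refine (hg.indicator {n | m - n ∈ F}).congr fun n => ?_
    simp [Set.indicator_apply]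

/-- The box `{0, …, N-1}^d` of frequencies. -/
def freqBox (d N : ℕ) : Finset (Fin d → ℤ) := Fintype.piFinset fun _ => Finset.Ico (0 : ℤ) N

lemma card_freqBox (d N : ℕ) : (freqBox d N).card = N ^ d := by
  simp [freqBox, Fintype.card_piFinset]

lemma filter_freqBox (N : ℕ) (n : Fin d → ℤ) :
    ((freqBox d N).filter fun m => m - n ∈ freqBox d N) =
      Fintype.piFinset fun i => Finset.Ico (max 0 (n i)) (min N (N + n i)) := by
  ext m
  simp only [freqBox, Finset.mem_filter, Fintype.mem_piFinset, Finset.mem_Ico, Pi.sub_apply,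
    ← forall_and]
  refine forall_congr' fun i => ?_
  omega

lemma tendsto_fejer_weight (n : Fin d → ℤ) :
    Filter.Tendsto (fun N : ℕ => (((freqBox d N).filter fun m => m - n ∈ freqBox d N).card : ℝ) /
      (N : ℝ) ^ d) Filter.atTop (nhds 1) := by
  have h1 : ∀ i : Fin d, Filter.Tendsto (fun N : ℕ => 1 - |(n i : ℝ)| / N) Filter.atTop
      (nhds (1 - 0)) := fun i =>
    tendsto_const_nhds.sub (tendsto_const_div_atTop_nhds_zero_nat _)
  have h2 := tendsto_finsetProd (Finset.univ : Finset (Fin d)) fun i _ => h1 i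
  simp only [sub_zero, Finset.prod_const_one] at h2
  refine h2.congr' ?_
  have hev : ∀ᶠ N : ℕ in Filter.atTop, ∀ i, |n i| ≤ N := by
    rw [Filter.eventually_all]
    intro i
    filter_upwards [Filter.eventually_ge_atTop (n i).natAbs] with N hN
    rw [Int.abs_eq_natAbs]
    exact_mod_cast hN
  filter_upwards [hev, Filter.eventually_gt_atTop 0] with N hN hN0
  have hN0' : (N : ℝ) ≠ 0 := by exact_mod_cast hN0.ne'
  rw [filter_freqBox, Fintype.card_piFinset, Nat.cast_prod]
  have : (N : ℝ) ^ d = ∏ _i : Fin d, (N : ℝ) := by simp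
  rw [this, ← Finset.prod_div_distrib]
  refine Finset.prod_congr rfl fun i _ => ?_
  have hc : (((Finset.Ico (max 0 (n i)) (min (N : ℤ) (N + n i))).card : ℤ) : ℝ) =
      ((N - |n i| : ℤ) : ℝ) := by
    congr 1
    have := hN i
    rw [Int.card_Ico]
    rcases abs_cases (n i) with h | h <;> omega
  rw [Int.cast_natCast] at hc
  rw [hc]
  push_cast
  field_simp

lemma IsPosMultiplier.re_tsum_nonneg {p : (Fin d → ℤ) → ℝ} (hp : IsPosMultiplier p)
    (hs : Summable p) (x : Fin d → ℝ) : 0 ≤ (∑' n, (p n : ℂ) * torusChar n x).re := by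
  have hnorm : ∀ n, ‖(p n : ℂ) * torusChar n x‖ = |p n| := fun n => by
    rw [norm_mul, norm_torusChar, mul_one, Complex.norm_real, Real.norm_eq_abs]
  have hg : Summable fun n => (p n : ℂ) * torusChar n x :=
    Summable.of_norm (by simpa only [hnorm] using hs.abs)
  set w : ℕ → (Fin d → ℤ) → ℝ := fun N n =>
    (((freqBox d N).filter fun m => m - n ∈ freqBox d N).card : ℝ) / (N : ℝ) ^ d with hw
  have hw1 : ∀ N n, |w N n| ≤ 1 := fun N n => by
    rw [abs_of_nonneg (by positivity)]
    refine div_le_one_of_le₀ ?_ (by positivity)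
    rw [← Nat.cast_pow, ← card_freqBox]
    exact_mod_cast Finset.card_filter_le _ _
  have hlim : Filter.Tendsto (fun N => ∑' n, (w N n : ℂ) * ((p n : ℂ) * torusChar n x))
      Filter.atTop (nhds (∑' n, (p n : ℂ) * torusChar n x)) := by
    refine tendsto_tsum_of_dominated_convergence hs.abs (fun n => ?_)
      (Filter.Eventually.of_forall fun N n => ?_)
    · have := ((Complex.continuous_ofReal.tendsto _).comp (tendsto_fejer_weight n)).mul_const
        ((p n : ℂ) * torusChar n x)
      rw [Complex.ofReal_one, one_mul] at this
      exact this
    · rw [norm_mul, hnorm, Complex.norm_real, Real.norm_eq_abs]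
      exact mul_le_of_le_one_left (abs_nonneg _) (hw1 N n)
  refine ge_of_tendsto' ((Complex.continuous_re.tendsto _).comp hlim) fun N => ?_
  have hpos := hp _ (freqBox d N ×ˢ freqBox d N) (fun m => m.1 - m.2) (fun _ => 1) (fun y => by
    have : ∑ m ∈ freqBox d N ×ˢ freqBox d N, 1 * torusChar (m.1 - m.2) y =
        (Complex.normSq (∑ m ∈ freqBox d N, torusChar m y) : ℂ) := by
      simp only [one_mul, torusChar_sub_left]
      rw [Finset.sum_product, ← Complex.mul_conj, map_sum, Finset.sum_mul_sum]
    rw [this, Complex.ofReal_re]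
    exact Complex.normSq_nonneg _) x
  simp only [one_mul] at hpos
  rw [Finset.sum_product, sum_sum_sub_eq_tsum _ _ hg] at hpos
  have : ∑' n, (w N n : ℂ) * ((p n : ℂ) * torusChar n x) = ((((N : ℝ) ^ d)⁻¹ : ℝ) : ℂ) *
      ∑' n, (((freqBox d N).filter fun m => m - n ∈ freqBox d N).card : ℂ) *
        ((p n : ℂ) * torusChar n x) := by
    rw [← tsum_mul_left]
    refine tsum_congr fun n => ?_
    simp only [hw]
    push_cast
    ring
  simp only [Function.comp_apply]
  rw [this, Complex.re_ofReal_mul]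
  exact mul_nonneg (by positivity) hpos

end fejer

section schur

variable {X : Type*} [MeasurableSpace X] {μ : Measure X} {M : ℝ≥0∞}

lemma lintegral_mul_rpow_le (w : X → ℝ≥0∞) (hw : Measurable w) (hM : ∫⁻ y, w y ∂μ = M)
    {f : X → ℝ} (hf : AEStronglyMeasurable f μ) {r : ℝ} (hr : 1 ≤ r) :
    (∫⁻ y, w y * ‖f y‖ₑ ∂μ) ^ r ≤ M ^ (r - 1) * ∫⁻ y, w y * ‖f y‖ₑ ^ r ∂μ := by
  have hr0 : 0 < r := by linarith
  have hle : (1 : ℝ≥0∞) ≤ ENNReal.ofReal r := by simpa using ENNReal.ofReal_le_ofReal hr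
  have h := eLpNorm_le_eLpNorm_mul_rpow_measure_univ hle
    (hf.mono_ac (withDensity_absolutelyContinuous μ w))
  rw [eLpNorm_one_eq_lintegral_enorm, withDensity_apply _ MeasurableSet.univ, setLIntegral_univ, hM,
    eLpNorm_eq_lintegral_rpow_enorm_toReal (by simpa using hr0) ENNReal.ofReal_ne_top,
    ENNReal.toReal_ofReal hr0.le, ENNReal.toReal_one,
    lintegral_withDensity_eq_lintegral_mul₀ hw.aemeasurable hf.enorm,
    lintegral_withDensity_eq_lintegral_mul₀ hw.aemeasurable (hf.enorm.pow_const r)] at h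
  have h2 := ENNReal.rpow_le_rpow h hr0.le
  rw [ENNReal.mul_rpow_of_nonneg _ _ hr0.le, ← ENNReal.rpow_mul, ← ENNReal.rpow_mul,
    one_div_mul_cancel hr0.ne', ENNReal.rpow_one] at h2
  have he : (1 / 1 - 1 / r) * r = r - 1 := by field_simp
  rw [he] at h2
  rw [mul_comm (M ^ _)]
  exact h2

/-- Schur's test: a positive kernel all of whose marginals have mass `M` has norm at most `M` on
every `L^q`. -/
lemma eLpNorm_integral_kernel_le [SFinite μ] {K : X → X → ℝ} (hK : Measurable (Function.uncurry K))
    (hM1 : ∀ x, ∫⁻ y, ‖K x y‖ₑ ∂μ = M) (hM2 : ∀ y, ∫⁻ x, ‖K x y‖ₑ ∂μ = M)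
    {f : X → ℝ} (hf : AEStronglyMeasurable f μ) {q : ℝ≥0∞} (hq : 1 ≤ q) :
    eLpNorm (fun x => ∫ y, K x y * f y ∂μ) q μ ≤ M * eLpNorm f q μ := by
  have hpt : ∀ x, ‖∫ y, K x y * f y ∂μ‖ₑ ≤ ∫⁻ y, ‖K x y‖ₑ * ‖f y‖ₑ ∂μ := fun x => by
    simpa only [enorm_mul] using enorm_integral_le_lintegral_enorm (μ := μ) fun y => K x y * f y
  have hKx : ∀ x, Measurable fun y => ‖K x y‖ₑ := fun x =>
    (hK.comp measurable_prodMk_left).enorm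
  have hKy : ∀ y, Measurable fun x => ‖K x y‖ₑ := fun y =>
    (hK.comp measurable_prodMk_right).enorm
  rcases eq_or_ne q ⊤ with rfl | hqt
  · rw [eLpNorm_exponent_top, eLpNorm_exponent_top]
    refine eLpNormEssSup_le_of_ae_enorm_bound (Filter.Eventually.of_forall fun x => ?_)
    refine (hpt x).trans ?_
    calc ∫⁻ y, ‖K x y‖ₑ * ‖f y‖ₑ ∂μ ≤ ∫⁻ y, ‖K x y‖ₑ * eLpNormEssSup f μ ∂μ := by
          refine lintegral_mono_ae ?_
          filter_upwards [enorm_ae_le_eLpNormEssSup f μ] with y hy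
          gcongr
      _ = M * eLpNormEssSup f μ := by rw [lintegral_mul_const _ (hKx x), hM1]
  · have hr : 1 ≤ q.toReal := by
      simpa using ENNReal.toReal_mono hqt hq
    have hr0 : 0 < q.toReal := by linarith
    have hq0 : q ≠ 0 := (zero_lt_one.trans_le hq).ne'
    rw [eLpNorm_eq_lintegral_rpow_enorm_toReal hq0 hqt,
      eLpNorm_eq_lintegral_rpow_enorm_toReal hq0 hqt]
    set r := q.toReal
    have hmeas : AEMeasurable (Function.uncurry fun x y => ‖K x y‖ₑ * ‖f y‖ₑ ^ r) (μ.prod μ) :=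
      hK.enorm.aemeasurable.mul ((hf.enorm.pow_const r).comp_snd)
    have key : ∫⁻ x, ‖∫ y, K x y * f y ∂μ‖ₑ ^ r ∂μ ≤ M ^ r * ∫⁻ y, ‖f y‖ₑ ^ r ∂μ := by
      calc ∫⁻ x, ‖∫ y, K x y * f y ∂μ‖ₑ ^ r ∂μ
          ≤ ∫⁻ x, M ^ (r - 1) * ∫⁻ y, ‖K x y‖ₑ * ‖f y‖ₑ ^ r ∂μ ∂μ :=
            lintegral_mono fun x => (ENNReal.rpow_le_rpow (hpt x) hr0.le).trans
              (lintegral_mul_rpow_le _ (hKx x) (hM1 x) hf hr)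
        _ = M ^ (r - 1) * ∫⁻ x, ∫⁻ y, ‖K x y‖ₑ * ‖f y‖ₑ ^ r ∂μ ∂μ :=
            lintegral_const_mul'' _ hmeas.lintegral_prod_right'
        _ = M ^ (r - 1) * ∫⁻ y, ∫⁻ x, ‖K x y‖ₑ * ‖f y‖ₑ ^ r ∂μ ∂μ := by
            rw [lintegral_lintegral_swap hmeas]
        _ = M ^ (r - 1) * (M * ∫⁻ y, ‖f y‖ₑ ^ r ∂μ) := by
            simp only [lintegral_mul_const _ (hKy _), hM2]
            rw [lintegral_const_mul'' _ (hf.enorm.pow_const r)]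
        _ = M ^ r * ∫⁻ y, ‖f y‖ₑ ^ r ∂μ := by
            rw [← mul_assoc]
            congr 1
            nth_rewrite 2 [← ENNReal.rpow_one M]
            rw [← ENNReal.rpow_add_of_nonneg _ _ (by linarith) zero_le_one, sub_add_cancel]
    refine (ENNReal.rpow_le_rpow key (by positivity)).trans_eq ?_
    rw [ENNReal.mul_rpow_of_nonneg _ _ (by positivity), ← ENNReal.rpow_mul,
      mul_one_div_cancel hr0.ne', ENNReal.rpow_one]

end schur

section kper

variable {d : ℕ} {α t : ℝ}

lemma rpow_frequency_eq (n : Fin d → ℤ) :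
    (2 * Real.pi * Real.sqrt (∑ i, (n i : ℝ) ^ 2)) ^ α = laplaceEigenvalue n ^ (α / 2) := by
  have h0 : 0 ≤ ∑ i, (n i : ℝ) ^ 2 := Finset.sum_nonneg fun _ _ => sq_nonneg _
  have h : laplaceEigenvalue n = (2 * Real.pi * Real.sqrt (∑ i, (n i : ℝ) ^ 2)) ^ (2 : ℝ) := by
    rw [Real.rpow_two, mul_pow, mul_pow, Real.sq_sqrt h0, laplaceEigenvalue]
    ring
  rw [h, ← Real.rpow_mul (by positivity)]
  ring_nf

lemma summable_norm_rpow_int {r : ℝ} (hr : r < -d) :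
    Summable fun n : Fin d → ℤ => ‖fun i => (n i : ℝ)‖ ^ r := by
  let L := Submodule.span ℤ (Set.range (Pi.basisFun ℝ (Fin d)))
  have h : Summable fun z : L => ‖z‖ ^ r := ZLattice.summable_norm_rpow L r (by
    rw [ZLattice.rank ℝ L]
    simpa using hr)
  have hmem : ∀ n : Fin d → ℤ, (fun i => (n i : ℝ)) ∈ L := fun n => by
    rw [Module.Basis.mem_span_iff_repr_mem]
    intro i
    exact ⟨n i, by simp⟩
  let φ : (Fin d → ℤ) → L := fun n => ⟨fun i => (n i : ℝ), hmem n⟩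
  have hφ : Function.Injective φ := fun m n hmn => by
    ext i
    have h : (m i : ℝ) = n i := congrFun (congrArg Subtype.val hmn) i
    exact_mod_cast h
  exact (h.comp_injective hφ).congr fun n => rfl

lemma norm_sq_le_laplaceEigenvalue (n : Fin d → ℤ) :
    ‖fun i => (n i : ℝ)‖ ^ 2 ≤ laplaceEigenvalue n := by
  have h0 : 0 ≤ ∑ i, (n i : ℝ) ^ 2 := Finset.sum_nonneg fun _ _ => sq_nonneg _
  have h1 : ‖fun i => (n i : ℝ)‖ ≤ Real.sqrt (∑ i, (n i : ℝ) ^ 2) := by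
    refine (pi_norm_le_iff_of_nonneg (Real.sqrt_nonneg _)).mpr fun i => ?_
    refine Real.abs_le_sqrt ?_
    exact Finset.single_le_sum (f := fun i => (n i : ℝ) ^ 2) (fun _ _ => sq_nonneg _)
      (Finset.mem_univ i)
  calc ‖fun i => (n i : ℝ)‖ ^ 2 ≤ Real.sqrt (∑ i, (n i : ℝ) ^ 2) ^ 2 := by gcongr
    _ = ∑ i, (n i : ℝ) ^ 2 := Real.sq_sqrt h0
    _ ≤ _ := by
      rw [laplaceEigenvalue]
      refine le_mul_of_one_le_left h0 ?_
      nlinarith [Real.pi_gt_three]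

lemma summable_exp_laplaceEigenvalue {β : ℝ} (hβ : 0 < β) (ht : 0 < t) :
    Summable fun n : Fin d → ℤ => Real.exp (-t * laplaceEigenvalue n ^ β) := by
  obtain ⟨k, hk⟩ := exists_nat_gt ((d : ℝ) / (2 * β))
  rw [div_lt_iff₀ (by positivity)] at hk
  have hs := (summable_norm_rpow_int (d := d) (r := -(k * (2 * β))) (by linarith)).mul_left
    ((k.factorial : ℝ) / t ^ k)
  refine hs.of_norm_bounded_eventually ?_
  refine (Set.finite_singleton (0 : Fin d → ℤ)).subset fun n hn => ?_
  by_contra hn0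
  refine hn ?_
  have hpos : 0 < ‖fun i => (n i : ℝ)‖ := by
    refine norm_pos_iff.mpr fun h => hn0 ?_
    ext i
    have := congrFun h i
    simpa using this
  set a := ‖fun i => (n i : ℝ)‖
  have h1 : a ^ (2 * β) ≤ laplaceEigenvalue n ^ β := by
    rw [Real.rpow_mul hpos.le, Real.rpow_two]
    exact Real.rpow_le_rpow (sq_nonneg _) (norm_sq_le_laplaceEigenvalue n) hβ.le
  have h2 : (t * a ^ (2 * β)) ^ k / k.factorial ≤ Real.exp (t * a ^ (2 * β)) :=
    Real.pow_div_factorial_le_exp _ (by positivity) k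
  have h3 : 0 < (t * a ^ (2 * β)) ^ k / k.factorial := by positivity
  rw [Set.mem_ofPred_eq, Real.norm_of_nonneg (Real.exp_pos _).le]
  calc Real.exp (-t * laplaceEigenvalue n ^ β) ≤ Real.exp (-(t * a ^ (2 * β))) := by
        rw [neg_mul]
        gcongr
    _ ≤ ((t * a ^ (2 * β)) ^ k / k.factorial)⁻¹ := by
        rw [Real.exp_neg]
        gcongr
    _ = (k.factorial : ℝ) / t ^ k * a ^ (-(k * (2 * β))) := by
        rw [Real.rpow_neg hpos.le, mul_comm (k : ℝ), Real.rpow_mul_natCast hpos.le, mul_pow]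
        field_simp

lemma kper_eq (x : Fin d → ℝ) : kper d α t x =
    (∑' n : Fin d → ℤ, (Real.exp (-t * laplaceEigenvalue n ^ (α / 2)) : ℂ) *
      torusChar n x).re := by
  simp only [kper, rpow_frequency_eq, torusChar]

lemma norm_kper_term (n : Fin d → ℤ) (x : Fin d → ℝ) (a : ℝ) :
    ‖(Real.exp a : ℂ) * torusChar n x‖ = Real.exp a := by
  rw [norm_mul, norm_torusChar, mul_one, Complex.norm_real, Real.norm_of_nonneg (Real.exp_pos _).le]

lemma summable_kper (hα : 0 < α) (ht : 0 < t) (x : Fin d → ℝ) :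
    Summable fun n : Fin d → ℤ => (Real.exp (-t * laplaceEigenvalue n ^ (α / 2)) : ℂ) *
      torusChar n x :=
  Summable.of_norm (by
    simpa only [norm_kper_term] using summable_exp_laplaceEigenvalue (half_pos hα) ht)

lemma continuous_kper (hα : 0 < α) (ht : 0 < t) : Continuous (kper d α t) := by
  rw [funext kper_eq]
  refine Complex.continuous_re.comp (continuous_tsum
    (fun n => continuous_const.mul (continuous_torusChar n))
    (summable_exp_laplaceEigenvalue (half_pos hα) ht) fun n x => (norm_kper_term n x _).le)

/-- The kernel is bounded below by `1 - e^{-c₁ t}`. -/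
lemma one_sub_exp_le_kper (hα0 : 0 < α) (hα2 : α < 2) (ht : 0 < t) (x : Fin d → ℝ) :
    1 - Real.exp (-(decayRate d (α / 2) * t)) ≤ kper d α t x := by
  set A := decayRate d (α / 2) * t with hA
  have hβ0 : 0 < α / 2 := half_pos hα0
  have hmult := isPosMultiplier_fractionalHeat (d := d) hβ0 (by linarith) ht
  have hP : (fun n : Fin d → ℤ => Real.exp (-t * laplaceEigenvalue n ^ (α / 2) +
      decayRate d (α / 2) * t * (1 - if n = 0 then 1 else 0))) =
      fun n => Real.exp A * Real.exp (-t * laplaceEigenvalue n ^ (α / 2)) +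
        if n = 0 then 1 - Real.exp A else 0 := by
    funext n
    split_ifs with h
    · simp [h, laplaceEigenvalue_zero, Real.zero_rpow hβ0.ne']
    · rw [← Real.exp_add, ← hA, sub_zero, mul_one, add_zero, add_comm]
  rw [hP] at hmult
  have hsum := summable_exp_laplaceEigenvalue (d := d) hβ0 ht
  have hδ : ∀ a : ℂ, HasSum (fun n : Fin d → ℤ => if n = 0 then a else 0) a := fun a =>
    hasSum_ite_eq 0 a
  have hδ' : Summable (fun n : Fin d → ℤ => if n = 0 then 1 - Real.exp A else 0) :=
    (hasSum_ite_eq 0 _).summable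
  have h := hmult.re_tsum_nonneg ((hsum.mul_left _).add hδ') x
  have hterm : ∀ n : Fin d → ℤ,
      ((Real.exp A * Real.exp (-t * laplaceEigenvalue n ^ (α / 2)) +
        (if n = 0 then 1 - Real.exp A else 0) : ℝ) : ℂ) * torusChar n x =
      (Real.exp A : ℂ) * ((Real.exp (-t * laplaceEigenvalue n ^ (α / 2)) : ℂ) * torusChar n x) +
        if n = 0 then ((1 - Real.exp A : ℝ) : ℂ) else 0 := fun n => by
    split_ifs with hn
    · rw [hn, torusChar_zero]
      push_cast
      ring
    · push_cast
      ring
  simp only [hterm] at h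
  rw [((summable_kper hα0 ht x).mul_left _).tsum_add (hδ _).summable, (hδ _).tsum_eq,
    tsum_mul_left, Complex.add_re, Complex.re_ofReal_mul, ← kper_eq, Complex.ofReal_re] at h
  have hE := Real.exp_pos A
  rw [Real.exp_neg, sub_le_iff_le_add, ← sub_le_iff_le_add', ← mul_le_mul_iff_right₀ hE]
  rw [mul_sub, mul_inv_cancel₀ hE.ne']
  linarith

lemma integral_kper_comp (hα : 0 < α) (ht : 0 < t) {φ : (Fin d → ℝ) → Fin d → ℝ}
    (hφ : Continuous φ)
    (hint : ∀ n : Fin d → ℤ, ∫ y in cube d, torusChar n (φ y) = if n = 0 then 1 else 0) :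
    ∫ y in cube d, kper d α t (φ y) = 1 := by
  have hsum := summable_exp_laplaceEigenvalue (d := d) (half_pos hα) ht
  have hi : ∀ n : Fin d → ℤ, Integrable (fun y =>
      (Real.exp (-t * laplaceEigenvalue n ^ (α / 2)) : ℂ) * torusChar n (φ y))
      (volume.restrict (cube d)) := fun n =>
    ((continuous_const.mul ((continuous_torusChar n).comp hφ)).continuousOn
      (s := cube d)).integrableOn_compact (isCompact_cube d)
  have h := hasSum_integral_of_summable_integral_norm hi (by
    simpa only [norm_kper_term, integral_const, probReal_univ, one_smul] using hsum)
  have hc : Continuous fun y => ∑' n : Fin d → ℤ,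
      (Real.exp (-t * laplaceEigenvalue n ^ (α / 2)) : ℂ) * torusChar n (φ y) :=
    continuous_tsum (fun n => continuous_const.mul ((continuous_torusChar n).comp hφ)) hsum
      fun n x => (norm_kper_term n _ _).le
  have hre := Complex.reCLM.integral_comp_comm
    (hc.continuousOn.integrableOn_compact (μ := volume) (isCompact_cube d))
  simp only [Complex.reCLM_apply] at hre
  simp only [kper_eq]
  rw [hre, ← h.tsum_eq, tsum_eq_single 0]
  · rw [integral_const_mul, hint]
    simp [laplaceEigenvalue_zero, Real.zero_rpow (half_pos hα).ne']
  · intro n hn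
    rw [integral_const_mul, hint, if_neg hn, mul_zero]

lemma lintegral_enorm_kper_sub (hα0 : 0 < α) (hα2 : α < 2) (ht : 0 < t)
    {φ : (Fin d → ℝ) → Fin d → ℝ} (hφ : Continuous φ)
    (hint : ∀ n : Fin d → ℤ, ∫ y in cube d, torusChar n (φ y) = if n = 0 then 1 else 0) :
    ∫⁻ y in cube d, ‖kper d α t (φ y) - (1 - Real.exp (-(decayRate d (α / 2) * t)))‖ₑ =
      ENNReal.ofReal (Real.exp (-(decayRate d (α / 2) * t))) := by
  have hi : Integrable (fun y => kper d α t (φ y)) (volume.restrict (cube d)) :=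
    ((continuous_kper hα0 ht).comp hφ).continuousOn.integrableOn_compact (isCompact_cube d)
  have hnn : ∀ y, 0 ≤ kper d α t (φ y) - (1 - Real.exp (-(decayRate d (α / 2) * t))) := fun y =>
    sub_nonneg.mpr (one_sub_exp_le_kper hα0 hα2 ht _)
  simp only [Real.enorm_of_nonneg (hnn _)]
  have h := ofReal_integral_eq_lintegral_ofReal (hi.sub (integrable_const _))
    (Filter.Eventually.of_forall hnn)
  simp only [Pi.sub_apply] at h
  rw [← h, integral_sub hi (integrable_const _),
    integral_kper_comp hα0 ht hφ hint, integral_const, probReal_univ, one_smul]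
  congr 1
  ring

end kper

/-- improved heat flow estimate in the periodic case, 0 < α < 2, 1 ≤ q ≤ ∞. -/
theorem improved_heat_flow_periodic
    (d : ℕ) (hd : 1 ≤ d) (α : ℝ) (hα0 : 0 < α) (hα2 : α < 2) :
    ∃ c₁ : ℝ, 0 < c₁ ∧
      ∀ q : ℝ≥0∞, 1 ≤ q →
      ∀ f : (Fin d → ℝ) → ℝ,
        (∀ (x : Fin d → ℝ) (n : Fin d → ℤ), f (x + fun i => (n i : ℝ)) = f x) →
        LocallyIntegrable f volume →
        (∫ x in cube d, f x) = 0 →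
        eLpNorm f q (volume.restrict (cube d)) < ⊤ →
      ∀ t : ℝ, 0 < t →
        eLpNorm (fun x => ∫ y in cube d, kper d α t (x - y) * f y) q
            (volume.restrict (cube d)) ≤
          ENNReal.ofReal (Real.exp (-(c₁ * t))) * eLpNorm f q (volume.restrict (cube d)) := by
  have hβ0 : 0 < α / 2 := half_pos hα0
  refine ⟨decayRate d (α / 2), div_pos (levyLowerBound_pos _ _)
    (subordinationConst_pos hβ0 (by linarith)), ?_⟩
  intro q hq f _ hloc hmean _ t ht
  set m := 1 - Real.exp (-(decayRate d (α / 2) * t)) with hm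
  have hf : IntegrableOn f (cube d) := hloc.integrableOn_isCompact (isCompact_cube d)
  have hcont : Continuous fun z : (Fin d → ℝ) × (Fin d → ℝ) => kper d α t (z.1 - z.2) - m :=
    ((continuous_kper hα0 ht).comp (continuous_fst.sub continuous_snd)).sub continuous_const
  have heq : (fun x => ∫ y in cube d, kper d α t (x - y) * f y) =
      fun x => ∫ y in cube d, (kper d α t (x - y) - m) * f y := by
    funext x
    have hk : IntegrableOn (fun y => kper d α t (x - y) * f y) (cube d) :=
      hf.continuousOn_mul
        (((continuous_kper hα0 ht).comp (continuous_const.sub continuous_id)).continuousOn)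
        (isCompact_cube d)
    simp only [sub_mul]
    rw [integral_sub hk (hf.const_mul m), integral_const_mul, hmean, mul_zero, sub_zero]
  rw [heq]
  exact eLpNorm_integral_kernel_le (K := fun x y => kper d α t (x - y) - m) hcont.measurable
    (fun x => lintegral_enorm_kper_sub hα0 hα2 ht (continuous_const.sub continuous_id)
      fun n => integral_cube_torusChar_sub n x)
    (fun y => lintegral_enorm_kper_sub hα0 hα2 ht (continuous_id.sub continuous_const)
      fun n => integral_cube_torusChar_sub_left n y)
    hf.aestronglyMeasurable hq

end
end

section
/- Let d ≥ 1. There exists an absolute constant c₂ > 0 such that for every 1 < q < ∞, every ℤ^d-periodic, locally integrable function f : ℝ^d → ℝ with mean zero and ‖f‖_{L^q([0,1]^d)} < ∞, and every t > 0, one has ‖e^{tΔ} f‖_{L^q([0,1]^d)} ≤ e^{-c₂ ((q-1)/q²) t} ‖f‖_{L^q([0,1]^d)}. -/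
open MeasureTheory
open scoped ENNReal

noncomputable section

/-- periodic heat kernel k_2^per(t,x) = ∑_{n ∈ ℤ^d} e^{-t(2π|n|)²} e^{2πi n·x} -/
def kper2 (d : ℕ) (t : ℝ) (x : Fin d → ℝ) : ℝ :=
  (∑' n : Fin d → ℤ,
      ((Real.exp (-t * (2 * Real.pi * Real.sqrt (∑ i, (n i : ℝ) ^ 2)) ^ 2) : ℝ) : ℂ) *
        fchar (∑ i, (n i : ℝ) * x i)).re

/-- The signed power `sign y * |y| ^ a`, for `a > 0`. -/
def spow (a y : ℝ) : ℝ := y * |y| ^ (a - 1)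

lemma spow_zero (a : ℝ) : spow a 0 = 0 := by simp [spow]

lemma spow_neg (a y : ℝ) : spow a (-y) = -spow a y := by simp [spow]

lemma spow_of_pos (a : ℝ) {y : ℝ} (hy : 0 < y) : spow a y = y ^ a := by
  rw [spow, abs_of_pos hy, Real.rpow_sub_one hy.ne']
  field_simp

lemma spow_mul (a x y : ℝ) : spow a (x * y) = spow a x * spow a y := by
  rw [spow, spow, spow, abs_mul, Real.mul_rpow (abs_nonneg _) (abs_nonneg _)]
  ring

lemma measurable_spow (a : ℝ) : Measurable (spow a) := by
  unfold spow
  fun_prop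

lemma sq_spow {a : ℝ} (ha : 0 < a) (y : ℝ) : spow a y ^ 2 = |y| ^ (2 * a) := by
  rcases lt_trichotomy y 0 with h | rfl | h
  · have := spow_of_pos a (neg_pos.2 h)
    rw [← neg_sq, ← spow_neg, this, abs_of_neg h, ← Real.rpow_natCast,
      ← Real.rpow_mul (by linarith)]
    congr 1
    push_cast
    ring
  · rw [spow_zero, abs_zero, Real.zero_rpow (by positivity)]
    simp
  · rw [spow_of_pos a h, abs_of_pos h, ← Real.rpow_natCast, ← Real.rpow_mul h.le]
    congr 1
    push_cast
    ring

lemma spow_spow {a b : ℝ} (hab : a * b = 1) (y : ℝ) : spow b (spow a y) = y := by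
  have key : ∀ y : ℝ, 0 < y → spow b (spow a y) = y := fun y h => by
    rw [spow_of_pos a h, spow_of_pos b (by positivity), ← Real.rpow_mul h.le, hab, Real.rpow_one]
  rcases lt_trichotomy y 0 with h | rfl | h
  · have := key _ (neg_pos.2 h)
    rwa [spow_neg, spow_neg, neg_inj] at this
  · simp [spow_zero]
  · exact key y h

lemma rpow_le_one_add_mul_sub {a z : ℝ} (ha : 0 ≤ a) (ha1 : a ≤ 1) (hz : 0 ≤ z) :
    z ^ a ≤ 1 + a * (z - 1) := by
  have := rpow_one_add_le_one_add_mul_self (s := z - 1) (by linarith) ha ha1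
  simpa using this

lemma half_sub_le_spow {a : ℝ} (ha : 0 < a) (ha2 : a ≤ 2) (z : ℝ) :
    1 / 2 - 3 * (z - 1) ^ 2 ≤ spow a z := by
  rcases lt_or_ge 0 z with hz | hz
  · rw [spow_of_pos a hz]
    rcases le_total 1 z with h1 | h1
    · have := Real.one_le_rpow h1 ha.le
      nlinarith [sq_nonneg (z - 1)]
    · have : z ^ (2 : ℝ) ≤ z ^ a := Real.rpow_le_rpow_of_exponent_ge hz h1 ha2
      rw [Real.rpow_two] at this
      nlinarith [sq_nonneg (z - 3 / 4)]
  · rcases hz.eq_or_lt with rfl | hz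
    · rw [spow_zero]; norm_num
    · have h := spow_of_pos a (neg_pos.2 hz)
      rw [spow_neg] at h
      have h2 : (-z) ^ a ≤ 1 + (-z) ^ 2 := by
        rcases le_total 1 (-z) with h1 | h1
        · have := Real.rpow_le_rpow_of_exponent_le h1 ha2
          rw [Real.rpow_two] at this
          linarith
        · have := Real.rpow_le_one (by linarith) h1 ha.le
          nlinarith [sq_nonneg z]
      nlinarith [sq_nonneg z]

lemma spow_bregman {q : ℝ} (hq : 1 < q) (z : ℝ) :
    (q - 1) / (2 * q) * (z - 1) ^ 2 ≤ z ^ 2 - 1 - q * (spow (2 / q) z - 1) := by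
  have hq0 : 0 < q := by linarith
  have hc : (q - 1) / (2 * q) ≤ 1 / 2 := by
    rw [div_le_div_iff₀ (by positivity) (by norm_num)]; linarith
  have hc' : (q - 1) / (2 * q) ≤ (q - 1) / 2 := by
    apply div_le_div_of_nonneg_left <;> linarith
  have hz2 := sq_nonneg (z - 1)
  rcases lt_trichotomy 0 z with hz | rfl | hz
  · rw [spow_of_pos _ hz]
    rcases le_total 2 q with h2 | h2
    · have h := rpow_le_one_add_mul_sub (a := 2 / q) (by positivity)
        (by rw [div_le_one hq0]; exact h2) hz.le
      have : q * z ^ (2 / q) ≤ q + 2 * (z - 1) := by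
        calc q * z ^ (2 / q) ≤ q * (1 + 2 / q * (z - 1)) := by gcongr
          _ = _ := by field_simp
      nlinarith
    · have h := rpow_le_one_add_mul_sub (a := 2 / q - 1) (z := z)
        (by rw [sub_nonneg, le_div_iff₀ hq0]; linarith)
        (by rw [sub_le_iff_le_add, div_le_iff₀ hq0]; linarith) hz.le
      rw [Real.rpow_sub_one hz.ne', div_le_iff₀ hz] at h
      have : q * z ^ (2 / q) ≤ q * z + (2 - q) * (z - 1) * z := by
        calc q * z ^ (2 / q) ≤ q * ((1 + (2 / q - 1) * (z - 1)) * z) := by gcongr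
          _ = _ := by field_simp
      nlinarith
  · rw [spow_zero]
    nlinarith
  · have h := spow_of_pos (2 / q) (neg_pos.2 hz)
    rw [spow_neg] at h
    have h0 : 0 ≤ (-z) ^ (2 / q) := Real.rpow_nonneg (by linarith) _
    have h1 : (q - 1) / (2 * q) * (z - 1) ^ 2 ≤ (q - 1) / (2 * q) * (2 * z ^ 2 + 2) := by
      have : 0 < (q - 1) / (2 * q) := div_pos (by linarith) (by positivity)
      gcongr
      nlinarith [sq_nonneg (z + 1)]
    have h3 := mul_nonneg hq0.le h0
    nlinarith [sq_nonneg z, mul_le_mul_of_nonneg_right hc (sq_nonneg z)]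

lemma half_sub_le_div {q : ℝ} (hq : 1 < q) {s : ℝ} (hs : 0 < s) (y : ℝ) :
    1 / 2 - 3 * (spow (q / 2) y / s - 1) ^ 2 ≤ y / s ^ (2 / q) := by
  have hq0 : 0 < q := by linarith
  have := half_sub_le_spow (a := 2 / q) (by positivity)
    (by rw [div_le_iff₀ hq0]; linarith) (spow (q / 2) y * s⁻¹)
  rw [spow_mul, spow_spow (by field_simp), spow_of_pos _ (inv_pos.2 hs), Real.inv_rpow hs.le] at this
  simpa [div_eq_mul_inv] using this

lemma exists_abs_rpow_ge {q : ℝ} (hq : 1 < q) (m : ℝ) : ∃ A : ℝ, ∀ y : ℝ,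
    |m| ^ q + A * (y - m) + (q - 1) / (2 * q) * (spow (q / 2) y - spow (q / 2) m) ^ 2
      ≤ |y| ^ q := by
  have hq0 : 0 < q := by linarith
  have hsq : ∀ y, spow (q / 2) y ^ 2 = |y| ^ q := fun y => by
    rw [sq_spow (by positivity)]; congr 1; ring
  by_cases hm : m = 0
  · refine ⟨0, fun y => ?_⟩
    have hc : (q - 1) / (2 * q) ≤ 1 := by
      rw [div_le_one (by positivity)]; linarith
    rw [hm, spow_zero, sub_zero (spow _ _), zero_mul, add_zero, hsq, abs_zero, Real.zero_rpow hq0.ne']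
    nlinarith [Real.rpow_nonneg (abs_nonneg y) q]
  · refine ⟨|m| ^ q * q / m, fun y => ?_⟩
    have h := spow_bregman hq (spow (q / 2) (y / m))
    rw [spow_spow (by field_simp)] at h
    have h2 := mul_le_mul_of_nonneg_left h (sq_nonneg (spow (q / 2) m))
    have h3 : spow (q / 2) y = spow (q / 2) m * spow (q / 2) (y / m) := by
      rw [← spow_mul]; congr 1; field_simp
    rw [← hsq, ← hsq, h3]
    have h4 : spow (q / 2) m ^ 2 * q / m * (y - m) = spow (q / 2) m ^ 2 * (q * (y / m - 1)) := by
      field_simp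
    rw [h4]
    linarith

local instance : MeasureSpace UnitAddCircle := ⟨AddCircle.haarAddCircle⟩

local instance : Measure.IsAddHaarMeasure (volume : Measure UnitAddCircle) :=
  inferInstanceAs (Measure.IsAddHaarMeasure AddCircle.haarAddCircle)

local instance : IsProbabilityMeasure (volume : Measure UnitAddCircle) :=
  inferInstanceAs (IsProbabilityMeasure AddCircle.haarAddCircle)

open UnitAddTorus

variable {d : ℕ}

/-- The Fourier multiplier `e^{-t (2π|n|)²}` of the heat semigroup on the torus. -/
def heatWeight (t : ℝ) (n : Fin d → ℤ) : ℝ :=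
  Real.exp (-t * (2 * Real.pi * Real.sqrt (∑ i, (n i : ℝ) ^ 2)) ^ 2)

lemma heatWeight_eq (t : ℝ) (n : Fin d → ℤ) :
    heatWeight t n = Real.exp (-(4 * Real.pi ^ 2 * t) * ∑ i, (n i : ℝ) ^ 2) := by
  rw [heatWeight, mul_pow, Real.sq_sqrt (Finset.sum_nonneg fun i _ => sq_nonneg _)]
  congr 1
  ring

lemma heatWeight_eq_prod (t : ℝ) (n : Fin d → ℤ) :
    heatWeight t n = ∏ i, Real.exp (-(4 * Real.pi ^ 2 * t) * (n i : ℝ) ^ 2) := by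
  rw [heatWeight_eq, Finset.mul_sum, Real.exp_sum]

lemma heatWeight_pos (t : ℝ) (n : Fin d → ℤ) : 0 < heatWeight t n := Real.exp_pos _

lemma heatWeight_zero (t : ℝ) : heatWeight t (0 : Fin d → ℤ) = 1 := by
  simp [heatWeight]

lemma heatWeight_add (s t : ℝ) (n : Fin d → ℤ) :
    heatWeight (s + t) n = heatWeight s n * heatWeight t n := by
  rw [heatWeight_eq, heatWeight_eq, heatWeight_eq, ← Real.exp_add]
  congr 1
  ring

lemma heatWeight_le {t : ℝ} (ht : 0 ≤ t) {n : Fin d → ℤ} (hn : n ≠ 0) :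
    heatWeight t n ≤ Real.exp (-(4 * Real.pi ^ 2 * t)) := by
  rw [heatWeight_eq, Real.exp_le_exp]
  obtain ⟨i, hi⟩ := Function.ne_iff.1 hn
  have h1 : (1 : ℝ) ≤ (n i : ℝ) ^ 2 := by
    have : 1 ≤ (n i) ^ 2 := Int.add_one_le_of_lt (pow_pos (abs_pos.2 hi) 2 |>.trans_eq (sq_abs _))
    exact_mod_cast this
  have h2 : (n i : ℝ) ^ 2 ≤ ∑ i, (n i : ℝ) ^ 2 :=
    Finset.single_le_sum (f := fun i => (n i : ℝ) ^ 2) (fun i _ => sq_nonneg _) (Finset.mem_univ i)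
  have : 0 ≤ 4 * Real.pi ^ 2 * t := by positivity
  nlinarith

lemma hasSum_mul_of_summable_norm {ι κ : Type*} {f : ι → ℂ} {g : κ → ℂ} {a b : ℂ}
    (hf : Summable fun x => ‖f x‖) (hg : Summable fun x => ‖g x‖) (ha : HasSum f a)
    (hb : HasSum g b) : HasSum (fun x : ι × κ => f x.1 * g x.2) (a * b) :=
  ha.mul hb (summable_mul_of_summable_norm hf hg)

lemma hasSum_pi_prod {f : Fin d → ℤ → ℂ} (hf : ∀ i, Summable fun k => ‖f i k‖) :
    (Summable fun n : Fin d → ℤ => ‖∏ i, f i (n i)‖) ∧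
      HasSum (fun n : Fin d → ℤ => ∏ i, f i (n i)) (∏ i, ∑' k, f i k) := by
  induction d with
  | zero =>
    refine ⟨(hasSum_unique _).summable, ?_⟩
    simp
  | succ d ih =>
    obtain ⟨h1, h2⟩ := ih (f := fun i => f i.succ) fun i => hf i.succ
    constructor
    · rw [← (Fin.consEquiv (fun _ : Fin (d + 1) => ℤ)).summable_iff]
      simpa [Function.comp_def, Fin.consEquiv, Fin.prod_univ_succ] using
        (hf 0).mul_of_nonneg h1 (fun _ => norm_nonneg _) (fun _ => norm_nonneg _)
    · rw [← (Fin.consEquiv (fun _ : Fin (d + 1) => ℤ)).hasSum_iff, Fin.prod_univ_succ]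
      refine (hasSum_mul_of_summable_norm (hf 0) h1 (hf 0).of_norm.hasSum h2).congr_fun fun n => ?_
      simp [Fin.consEquiv, Fin.prod_univ_succ]

lemma summable_exp_neg_mul_sq {a : ℝ} (ha : 0 < a) :
    Summable fun k : ℤ => Real.exp (-a * (k : ℝ) ^ 2) := by
  have him : (Complex.I * ((a / Real.pi : ℝ) : ℂ)).im = a / Real.pi := by
    rw [Complex.I_mul_im, Complex.ofReal_re]
  have h : Summable (jacobiTheta₂_term · 0 (Complex.I * ((a / Real.pi : ℝ) : ℂ))) := by
    rw [summable_jacobiTheta₂_term_iff, him]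
    positivity
  refine h.norm.congr fun k => ?_
  rw [norm_jacobiTheta₂_term, him, Complex.zero_im]
  congr 1
  field_simp
  ring

lemma summable_heatWeight {t : ℝ} (ht : 0 < t) :
    Summable fun n : Fin d → ℤ => heatWeight t n := by
  have h := summable_exp_neg_mul_sq (a := 4 * Real.pi ^ 2 * t) (by positivity)
  have := (hasSum_pi_prod (d := d)
    (f := fun _ k => ((Real.exp (-(4 * Real.pi ^ 2 * t) * (k : ℝ) ^ 2) : ℝ) : ℂ))
    fun i => by simpa [← Complex.ofReal_exp] using h).1
  refine this.congr fun n => ?_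
  rw [heatWeight_eq_prod, ← Complex.ofReal_prod, Complex.norm_real, Real.norm_of_nonneg]
  exact Finset.prod_nonneg fun i _ => (Real.exp_pos _).le

lemma theta_nonneg {t : ℝ} (ht : 0 < t) (x : UnitAddCircle) : ∃ r : ℝ, 0 ≤ r ∧
    ∑' k : ℤ, ((Real.exp (-(4 * Real.pi ^ 2 * t) * (k : ℝ) ^ 2) : ℝ) : ℂ) * fourier k x = r := by
  induction x using QuotientAddGroup.induction_on with
  | H x =>
    have ha : 0 < 4 * Real.pi * t := by positivity
    have h := Complex.tsum_exp_neg_quadratic (a := ((4 * Real.pi * t : ℝ) : ℂ)) (by simpa using ha)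
      (Complex.I * x)
    refine ⟨1 / (4 * Real.pi * t) ^ (1 / 2 : ℝ) *
      ∑' n : ℤ, Real.exp (-Real.pi / (4 * Real.pi * t) * (n - x) ^ 2), ?_, ?_⟩
    · exact mul_nonneg (by positivity) (tsum_nonneg fun _ => (Real.exp_pos _).le)
    · convert! h using 1
      · refine tsum_congr fun k => ?_
        rw [fourier_coe_apply, Complex.ofReal_exp, ← Complex.exp_add]
        congr 1
        push_cast
        ring
      · push_cast [Complex.ofReal_cpow ha.le]
        congr 1
        refine tsum_congr fun n => ?_
        rw [← mul_assoc, Complex.I_mul_I]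
        congr 1
        ring

lemma norm_fourier_apply (k : ℤ) (x : UnitAddCircle) : ‖fourier k x‖ = 1 := by
  rw [fourier_apply, Circle.norm_coe]

lemma norm_mFourier_apply (n : Fin d → ℤ) (x : UnitAddTorus (Fin d)) : ‖mFourier n x‖ = 1 := by
  rw [mFourier, ContinuousMap.coe_mk, norm_prod]
  exact Finset.prod_eq_one fun i _ => norm_fourier_apply _ _

lemma mFourier_coe (n : Fin d → ℤ) (x : Fin d → ℝ) :
    mFourier n (fun i => (x i : UnitAddCircle)) = fchar (∑ i, (n i : ℝ) * x i) := by
  simp only [mFourier, ContinuousMap.coe_mk, fourier_coe_apply, fchar, ← Complex.exp_sum]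
  congr 1
  push_cast
  rw [Finset.mul_sum, Finset.sum_mul]
  refine Finset.sum_congr rfl fun i _ => ?_
  simp
  ring

/-- The heat kernel on the torus, as a function with real values. -/
def heatKernel (t : ℝ) (x : UnitAddTorus (Fin d)) : ℝ :=
  (∑' n, (heatWeight t n : ℂ) * mFourier n x).re

lemma heatKernel_nonneg_and_eq {t : ℝ} (ht : 0 < t) (x : UnitAddTorus (Fin d)) :
    0 ≤ heatKernel t x ∧ HasSum (fun n => (heatWeight t n : ℂ) * mFourier n x) (heatKernel t x) := by
  have h := (hasSum_pi_prod (d := d) (f := fun i k =>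
    ((Real.exp (-(4 * Real.pi ^ 2 * t) * (k : ℝ) ^ 2) : ℝ) : ℂ) * fourier k (x i))
    fun i => by
      simp_rw [norm_mul, norm_fourier_apply, mul_one, Complex.norm_real]
      exact (summable_exp_neg_mul_sq (by positivity)).norm).2
  choose r hr0 hr using fun i => theta_nonneg ht (x i)
  have h' : HasSum (fun n => (heatWeight t n : ℂ) * mFourier n x) ((∏ i, r i : ℝ) : ℂ) := by
    convert! h using 1
    · ext n
      rw [heatWeight_eq_prod, Finset.prod_mul_distrib]
      simp [mFourier]
    · simp [← hr]
  have h2 : heatKernel t x = ∏ i, r i := by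
    rw [heatKernel, h'.tsum_eq, Complex.ofReal_re]
  rw [h2]
  exact ⟨Finset.prod_nonneg fun i _ => hr0 i, h'⟩

lemma heatKernel_nonneg {t : ℝ} (ht : 0 < t) (x : UnitAddTorus (Fin d)) : 0 ≤ heatKernel t x :=
  (heatKernel_nonneg_and_eq ht x).1

lemma hasSum_heatKernel {t : ℝ} (ht : 0 < t) (x : UnitAddTorus (Fin d)) :
    HasSum (fun n => (heatWeight t n : ℂ) * mFourier n x) (heatKernel t x) :=
  (heatKernel_nonneg_and_eq ht x).2

lemma kper2_eq (t : ℝ) (x : Fin d → ℝ) :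
    kper2 d t x = heatKernel t fun i => (x i : UnitAddCircle) := by
  simp only [kper2, heatKernel, heatWeight, mFourier_coe]

lemma continuous_heatKernel {t : ℝ} (ht : 0 < t) :
    Continuous (heatKernel t : UnitAddTorus (Fin d) → ℝ) := by
  refine Complex.continuous_re.comp (continuous_tsum (u := fun n => heatWeight t n)
    (fun n => by fun_prop) (summable_heatWeight ht) fun n x => ?_)
  rw [norm_mul, norm_mFourier_apply, mul_one, Complex.norm_real,
    Real.norm_of_nonneg (heatWeight_pos t n).le]

/-- The Fourier coefficients of a real function on the torus. -/
def realCoeff (F : UnitAddTorus (Fin d) → ℝ) (n : Fin d → ℤ) : ℂ :=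
  mFourierCoeff (fun y => (F y : ℂ)) n

/-- The heat semigroup on the torus. -/
def heatOp (t : ℝ) (F : UnitAddTorus (Fin d) → ℝ) (x : UnitAddTorus (Fin d)) : ℝ :=
  ∫ y, heatKernel t (x - y) * F y

variable {t : ℝ} {F : UnitAddTorus (Fin d) → ℝ}

lemma norm_realCoeff_le (F : UnitAddTorus (Fin d) → ℝ) (n : Fin d → ℤ) :
    ‖realCoeff F n‖ ≤ ∫ y, |F y| := by
  refine (norm_integral_le_integral_norm _).trans_eq ?_
  simp [norm_mFourier_apply]

lemma realCoeff_zero (F : UnitAddTorus (Fin d) → ℝ) : realCoeff F 0 = ((∫ y, F y : ℝ) : ℂ) := by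
  simp [realCoeff, mFourierCoeff, mFourier_zero, integral_complex_ofReal]

lemma mFourier_sub (n : Fin d → ℤ) (x y : UnitAddTorus (Fin d)) :
    mFourier n (x - y) = mFourier n x * mFourier (-n) y := by
  simp only [mFourier, ContinuousMap.coe_mk, ← Finset.prod_mul_distrib]
  refine Finset.prod_congr rfl fun i _ => ?_
  simp [fourier_apply, sub_eq_add_neg, AddCircle.toCircle_add]

lemma integrable_heatKernel_mul (ht : 0 < t) (hF : Integrable F) (x : UnitAddTorus (Fin d)) :
    Integrable fun y => heatKernel t (x - y) * F y := by
  obtain ⟨C, hC⟩ := isCompact_univ.exists_bound_of_continuousOn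
    (continuous_heatKernel (d := d) ht).continuousOn
  exact hF.bdd_mul ((continuous_heatKernel ht).comp
    (continuous_const.sub continuous_id)).aestronglyMeasurable
    (Filter.Eventually.of_forall fun y => hC _ trivial)

lemma hasSum_heatOp (ht : 0 < t) (hF : Integrable F) (x : UnitAddTorus (Fin d)) :
    HasSum (fun n => (heatWeight t n : ℂ) * realCoeff F n * mFourier n x) (heatOp t F x) := by
  have hint : ∀ n : Fin d → ℤ, Integrable
      fun y => (heatWeight t n : ℂ) * mFourier n (x - y) * (F y : ℂ) := fun n => by
    refine hF.ofReal.bdd_mul (c := ‖heatWeight t n‖) (by fun_prop)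
      (Filter.Eventually.of_forall fun y => ?_)
    rw [norm_mul, norm_mFourier_apply, mul_one, Complex.norm_real]
  have h := hasSum_integral_of_summable_integral_norm hint (by
    simp_rw [norm_mul, norm_mFourier_apply, mul_one, Complex.norm_real, integral_const_mul]
    exact ((summable_heatWeight ht).norm).mul_right _)
  convert! h using 1
  · ext n
    rw [realCoeff, mFourierCoeff, mul_assoc, mul_comm _ (mFourier n x), ← mul_assoc,
      ← integral_const_mul]
    refine integral_congr_ae (Filter.Eventually.of_forall fun y => ?_)
    simp only [mFourier_sub, smul_eq_mul]
    ring
  · rw [heatOp, ← integral_complex_ofReal]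
    refine integral_congr_ae (Filter.Eventually.of_forall fun y => ?_)
    simp only [Complex.ofReal_mul]
    exact (((hasSum_heatKernel ht (x - y)).mul_right (F y : ℂ)).tsum_eq).symm

lemma exists_continuousMap_heatOp (ht : 0 < t) (hF : Integrable F) :
    ∃ G : C(UnitAddTorus (Fin d), ℂ), (∀ x, G x = heatOp t F x) ∧
      ∀ n, mFourierCoeff G n = heatWeight t n * realCoeff F n := by
  have hs : Summable fun n : Fin d → ℤ => ((heatWeight t n : ℂ) * realCoeff F n) • mFourier n := by
    refine .of_norm_bounded ((summable_heatWeight ht).mul_right (∫ y, |F y|)) fun n => ?_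
    rw [norm_smul, mFourier_norm, mul_one, norm_mul, Complex.norm_real,
      Real.norm_of_nonneg (heatWeight_pos t n).le]
    exact mul_le_mul_of_nonneg_left (norm_realCoeff_le F n) (heatWeight_pos t n).le
  obtain ⟨G, hG⟩ := hs
  refine ⟨G, fun x => (ContinuousMap.hasSum_apply hG x).unique (hasSum_heatOp ht hF x),
    fun m => ?_⟩
  have h1 := (ContinuousMap.toLp (E := ℂ) 2 (volume : Measure (UnitAddTorus (Fin d))) ℂ).hasSum hG
  have h2 := (innerSL ℂ (mFourierLp 2 m)).hasSum h1
  have h3 : mFourierCoeff G m = inner ℂ (mFourierLp 2 m)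
      (ContinuousMap.toLp (E := ℂ) 2 (volume : Measure (UnitAddTorus (Fin d))) ℂ G) := by
    rw [← mFourierCoeff_toLp, ← mFourierBasis_repr, HilbertBasis.repr_apply_apply,
      coe_mFourierBasis]
  rw [h3]
  refine h2.unique ?_
  convert! hasSum_ite_eq m ((heatWeight t m : ℂ) * realCoeff F m) using 2 with n
  simp only [map_smul, innerSL_apply_apply, smul_eq_mul]
  rw [orthonormal_iff_ite.1 orthonormal_mFourier m n]
  by_cases h : n = m
  · subst h; simp
  · simp [h, Ne.symm h]

lemma continuous_heatOp (ht : 0 < t) (hF : Integrable F) : Continuous (heatOp t F) := by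
  obtain ⟨G, hG, -⟩ := exists_continuousMap_heatOp ht hF
  refine (Complex.continuous_re.comp G.continuous).congr fun x => ?_
  simp [hG]

lemma realCoeff_heatOp (ht : 0 < t) (hF : Integrable F) (n : Fin d → ℤ) :
    realCoeff (heatOp t F) n = heatWeight t n * realCoeff F n := by
  obtain ⟨G, hG, hG'⟩ := exists_continuousMap_heatOp ht hF
  rw [← hG', realCoeff]
  congr 1
  ext x
  rw [hG]

lemma memLp_of_continuous {G : UnitAddTorus (Fin d) → ℝ} (hG : Continuous G) (p : ℝ≥0∞) :
    MemLp G p := by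
  obtain ⟨C, hC⟩ := isCompact_univ.exists_bound_of_continuousOn hG.continuousOn
  exact MemLp.of_bound hG.aestronglyMeasurable C
    (Filter.Eventually.of_forall fun x => hC x trivial)

lemma integrable_of_continuous {G : UnitAddTorus (Fin d) → ℝ} (hG : Continuous G) :
    Integrable G :=
  memLp_one_iff_integrable.1 (memLp_of_continuous hG 1)

lemma heatOp_heatOp {s : ℝ} (hs : 0 < s) (ht : 0 < t) (hF : Integrable F) :
    heatOp s (heatOp t F) = heatOp (s + t) F := by
  ext x
  have h1 := hasSum_heatOp hs (integrable_of_continuous (continuous_heatOp ht hF)) x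
  have h2 := hasSum_heatOp (add_pos hs ht) hF x
  refine Complex.ofReal_injective (h1.unique (h2.congr_fun fun n => ?_))
  rw [realCoeff_heatOp ht hF, heatWeight_add]
  push_cast
  ring

lemma integral_heatOp (ht : 0 < t) (hF : Integrable F) : ∫ x, heatOp t F x = ∫ x, F x := by
  have h := realCoeff_heatOp ht hF 0
  rw [realCoeff_zero, realCoeff_zero, heatWeight_zero, Complex.ofReal_one, one_mul] at h
  exact Complex.ofReal_injective h

lemma hasSum_sq_realCoeff (hF : MemLp F 2) :
    HasSum (fun n => ‖realCoeff F n‖ ^ 2) (∫ x, F x ^ 2) := by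
  have hF' : MemLp (fun x => (F x : ℂ)) 2 := hF.ofReal
  have h := hasSum_sq_mFourierCoeff (hF'.toLp _)
  have h1 : ∀ n, mFourierCoeff (hF'.toLp _) n = realCoeff F n := fun n => by
    refine integral_congr_ae ?_
    filter_upwards [hF'.coeFn_toLp] with x hx
    rw [hx]
  have h2 : ∫ x, ‖hF'.toLp _ x‖ ^ 2 = ∫ x, F x ^ 2 := by
    refine integral_congr_ae ?_
    filter_upwards [hF'.coeFn_toLp] with x hx
    rw [hx, Complex.norm_real, Real.norm_eq_abs, sq_abs]
  simpa only [h1, h2] using h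

lemma integral_heatOp_sq_le (ht : 0 < t) (hF : MemLp F 2) :
    ∫ x, heatOp t F x ^ 2 ≤ Real.exp (-(8 * Real.pi ^ 2 * t)) * (∫ x, F x ^ 2) +
      (1 - Real.exp (-(8 * Real.pi ^ 2 * t))) * (∫ x, F x) ^ 2 := by
  have hFi : Integrable F := hF.integrable one_le_two
  have h1 := hasSum_sq_realCoeff (memLp_of_continuous (continuous_heatOp ht hFi) 2)
  have h2 := ((hasSum_sq_realCoeff hF).mul_left (Real.exp (-(8 * Real.pi ^ 2 * t)))).add
    (hasSum_ite_eq (0 : Fin d → ℤ) ((1 - Real.exp (-(8 * Real.pi ^ 2 * t))) * (∫ x, F x) ^ 2))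
  refine hasSum_le (fun n => ?_) h1 h2
  rw [realCoeff_heatOp ht hFi, norm_mul, Complex.norm_real,
    Real.norm_of_nonneg (heatWeight_pos t n).le, mul_pow]
  split_ifs with hn
  · rw [hn, heatWeight_zero, realCoeff_zero, Complex.norm_real, Real.norm_eq_abs, sq_abs]
    exact (by ring : _ = _).le
  · rw [add_zero]
    have h3 : heatWeight t n ^ 2 ≤ Real.exp (-(8 * Real.pi ^ 2 * t)) := by
      calc heatWeight t n ^ 2 ≤ Real.exp (-(4 * Real.pi ^ 2 * t)) ^ 2 :=
            pow_le_pow_left₀ (heatWeight_pos t n).le (heatWeight_le ht.le hn) 2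
        _ = _ := by
            rw [← Real.exp_nat_mul]
            congr 1
            push_cast
            ring
    gcongr

lemma heatOp_const (ht : 0 < t) (c : ℝ) (x : UnitAddTorus (Fin d)) :
    heatOp t (fun _ => c) x = c := by
  have h := hasSum_heatOp ht (integrable_const c) x
  have h0 : ∀ n : Fin d → ℤ, n ≠ 0 → realCoeff (fun _ : UnitAddTorus (Fin d) => c) n = 0 := by
    have h1 := hasSum_sq_realCoeff (memLp_const c : MemLp (fun _ : UnitAddTorus (Fin d) => c) 2)
    have h2 := h1.sub (hasSum_ite_eq (0 : Fin d → ℤ) (c ^ 2))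
    have h3 : ∀ n : Fin d → ℤ, 0 ≤ ‖realCoeff (fun _ : UnitAddTorus (Fin d) => c) n‖ ^ 2 -
        (if n = 0 then c ^ 2 else 0) := fun n => by
      split_ifs with hn
      · simp [hn, realCoeff_zero]
      · simp
    intro n hn
    simp only [integral_const, probReal_univ, one_smul, sub_self] at h2
    have h4 := congr_fun ((hasSum_zero_iff_of_nonneg h3).1 h2) n
    simpa [hn] using h4
  have h1 : HasSum (fun n => (heatWeight t n : ℂ) *
      realCoeff (fun _ : UnitAddTorus (Fin d) => c) n * mFourier n x) c := by
    convert! hasSum_ite_eq (0 : Fin d → ℤ) (c : ℂ) using 2 with n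
    split_ifs with hn
    · simp [hn, heatWeight_zero, realCoeff_zero, mFourier_zero]
    · rw [h0 n hn, mul_zero, zero_mul]
  exact Complex.ofReal_injective (h.unique h1)

lemma heatOp_mono (ht : 0 < t) {G : UnitAddTorus (Fin d) → ℝ} (hF : Integrable F)
    (hG : Integrable G) (h : ∀ y, F y ≤ G y) (x : UnitAddTorus (Fin d)) :
    heatOp t F x ≤ heatOp t G x :=
  integral_mono (integrable_heatKernel_mul ht hF x) (integrable_heatKernel_mul ht hG x)
    fun y => mul_le_mul_of_nonneg_left (h y) (heatKernel_nonneg ht _)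

lemma heatOp_add (ht : 0 < t) {G : UnitAddTorus (Fin d) → ℝ} (hF : Integrable F)
    (hG : Integrable G) (x : UnitAddTorus (Fin d)) :
    heatOp t (fun y => F y + G y) x = heatOp t F x + heatOp t G x := by
  simp only [heatOp, mul_add]
  exact integral_add (integrable_heatKernel_mul ht hF x) (integrable_heatKernel_mul ht hG x)

lemma heatOp_const_mul (t c : ℝ) (F : UnitAddTorus (Fin d) → ℝ) (x : UnitAddTorus (Fin d)) :
    heatOp t (fun y => c * F y) x = c * heatOp t F x := by
  simp only [heatOp, mul_left_comm _ c]
  exact integral_const_mul _ _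

lemma sq_integral_le (hF : MemLp F 2) : (∫ x, F x) ^ 2 ≤ ∫ x, F x ^ 2 := by
  have h := le_hasSum (hasSum_sq_realCoeff hF) 0 fun n _ => by positivity
  rwa [realCoeff_zero, Complex.norm_real, Real.norm_eq_abs, sq_abs] at h

variable {q : ℝ}

lemma spow_half_sq (hq : 1 < q) (y : ℝ) : spow (q / 2) y ^ 2 = |y| ^ q := by
  rw [sq_spow (by linarith)]
  congr 1
  ring

lemma memLp_spow (hq : 1 < q) (hF : MemLp F (ENNReal.ofReal q)) :
    MemLp (fun x => spow (q / 2) (F x)) 2 := by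
  have hm : AEStronglyMeasurable (fun x => spow (q / 2) (F x)) volume :=
    ((measurable_spow _).comp_aemeasurable hF.1.aemeasurable).aestronglyMeasurable
  rw [memLp_two_iff_integrable_sq hm]
  simp_rw [spow_half_sq hq]
  have := hF.integrable_norm_rpow (by simpa using by linarith) ENNReal.ofReal_ne_top
  simpa [ENNReal.toReal_ofReal (by linarith : 0 ≤ q)] using this

lemma integrable_of_memLp (hq : 1 < q) (hF : MemLp F (ENNReal.ofReal q)) : Integrable F :=
  hF.integrable (by rw [← ENNReal.ofReal_one]; exact ENNReal.ofReal_le_ofReal hq.le)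

lemma integral_spow_le (hq : 1 < q) (hF : MemLp F (ENNReal.ofReal q)) (h0 : ∫ x, F x = 0)
    {s : ℝ} (hs : 0 < s) (hs2 : s ^ 2 = ∫ x, |F x| ^ q) :
    ∫ x, spow (q / 2) (F x) ≤ 11 / 12 * s := by
  have hg := memLp_spow hq hF
  have hgi := hg.integrable one_le_two
  have hg2 := hg.integrable_sq
  have hFi := integrable_of_memLp hq hF
  have hexp : ∀ x, 1 / 2 - 3 * (spow (q / 2) (F x) / s - 1) ^ 2 =
      -3 / s ^ 2 * spow (q / 2) (F x) ^ 2 + 6 / s * spow (q / 2) (F x) + -5 / 2 := fun x => by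
    field_simp
    ring
  have i1 : Integrable fun x => -3 / s ^ 2 * spow (q / 2) (F x) ^ 2 + 6 / s * spow (q / 2) (F x) :=
    (hg2.const_mul _).add (hgi.const_mul _)
  have h : ∫ x, (-3 / s ^ 2 * spow (q / 2) (F x) ^ 2 + 6 / s * spow (q / 2) (F x) + -5 / 2) ≤
      ∫ x, F x / s ^ (2 / q) :=
    integral_mono (i1.add (integrable_const _))
      (hFi.div_const _) fun x => by
        simpa only [hexp] using half_sub_le_div hq hs (F x)
  rw [integral_div, h0, zero_div, integral_add i1 (integrable_const _), integral_add (hg2.const_mul _) (hgi.const_mul _), integral_const_mul,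
    integral_const_mul, integral_const, probReal_univ, one_smul] at h
  simp_rw [spow_half_sq hq] at h
  rw [← hs2, div_mul_cancel₀ _ (by positivity)] at h
  have h2 : 6 / s * ∫ x, spow (q / 2) (F x) ≤ 11 / 2 := by linarith
  rw [div_mul_eq_mul_div, div_le_iff₀ hs] at h2
  linarith

lemma sq_integral_spow_le (hq : 1 < q) (hF : MemLp F (ENNReal.ofReal q)) (h0 : ∫ x, F x = 0) :
    (∫ x, spow (q / 2) (F x)) ^ 2 ≤ 121 / 144 * ∫ x, |F x| ^ q := by
  have hnn : 0 ≤ ∫ x, |F x| ^ q := integral_nonneg fun x => by positivity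
  rcases hnn.eq_or_lt with hS | hS
  · have := sq_integral_le (memLp_spow hq hF)
    simp_rw [spow_half_sq hq] at this
    linarith
  · have hs := Real.sqrt_pos.2 hS
    have hs2 := Real.sq_sqrt hnn
    have h1 := integral_spow_le hq hF h0 hs hs2
    have h2 := integral_spow_le hq hF.neg (by simp [integral_neg, h0]) hs (by simpa using hs2)
    simp only [Pi.neg_apply, spow_neg, integral_neg] at h2
    have h3 := sq_le_sq' (by linarith) h1
    rw [mul_pow, hs2] at h3
    linarith

lemma abs_heatOp_rpow_le (ht : 0 < t) (hq : 1 < q) (hF : MemLp F (ENNReal.ofReal q))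
    (x : UnitAddTorus (Fin d)) :
    |heatOp t F x| ^ q + (q - 1) / (2 * q) * (heatOp t (fun y => |F y| ^ q) x -
      heatOp t (fun y => spow (q / 2) (F y)) x ^ 2) ≤ heatOp t (fun y => |F y| ^ q) x := by
  have hg := memLp_spow hq hF
  have hgi := hg.integrable one_le_two
  have hg2 := hg.integrable_sq
  have hFi := integrable_of_memLp hq hF
  simp_rw [spow_half_sq hq] at hg2
  set m := heatOp t F x with hm
  set c := (q - 1) / (2 * q) with hc
  have hc0 : 0 ≤ c := div_nonneg (by linarith) (by linarith)
  obtain ⟨A, hA⟩ := exists_abs_rpow_ge hq m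
  set b := spow (q / 2) m
  have j1 : Integrable fun y => A * F y + c * |F y| ^ q := (hFi.const_mul A).add (hg2.const_mul c)
  have j2 : Integrable fun y => A * F y + c * |F y| ^ q + -2 * c * b * spow (q / 2) (F y) :=
    j1.add (hgi.const_mul (-2 * c * b))
  have h := heatOp_mono ht (j2.add (integrable_const (|m| ^ q - A * m + c * b ^ 2))) hg2
    (fun y => by
      have := hA (F y)
      rw [sub_sq, spow_half_sq hq] at this
      simp only [Pi.add_apply]
      linarith) x
  simp only [Pi.add_def] at h
  rw [heatOp_add ht j2 (integrable_const _), heatOp_add ht j1 (hgi.const_mul (-2 * c * b)),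
    heatOp_add ht (hFi.const_mul A) (hg2.const_mul c), heatOp_const ht, heatOp_const_mul,
    heatOp_const_mul, heatOp_const_mul, ← hm] at h
  nlinarith [mul_nonneg hc0 (sq_nonneg (heatOp t (fun y => spow (q / 2) (F y)) x - b))]

lemma integral_abs_heatOp_rpow_le (ht : 0 < t) (hq : 1 < q) (hF : MemLp F (ENNReal.ofReal q))
    (h0 : ∫ x, F x = 0) :
    ∫ x, |heatOp t F x| ^ q ≤ (1 - 23 / 144 * ((q - 1) / (2 * q)) *
      (1 - Real.exp (-(8 * Real.pi ^ 2 * t)))) * ∫ x, |F x| ^ q := by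
  have hg := memLp_spow hq hF
  have hgi := hg.integrable one_le_two
  have hg2 := hg.integrable_sq
  have hFi := integrable_of_memLp hq hF
  have hgap := integral_heatOp_sq_le ht hg
  simp_rw [spow_half_sq hq] at hg2 hgap
  have hc0 : 0 ≤ (q - 1) / (2 * q) := div_nonneg (by linarith) (by linarith)
  have hcP := continuous_heatOp ht hFi
  have i1 : Integrable fun x => |heatOp t F x| ^ q :=
    integrable_of_continuous (hcP.abs.rpow_const fun x => Or.inr (by linarith))
  have i2 := integrable_of_continuous (continuous_heatOp ht hg2)
  have i3 : Integrable fun x => heatOp t (fun y => spow (q / 2) (F y)) x ^ 2 :=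
    integrable_of_continuous ((continuous_heatOp ht hgi).pow 2)
  have i4 : Integrable fun x => (q - 1) / (2 * q) * (heatOp t (fun y => |F y| ^ q) x -
      heatOp t (fun y => spow (q / 2) (F y)) x ^ 2) := (i2.sub i3).const_mul _
  have h := integral_mono (i1.add i4) i2
    (fun x => abs_heatOp_rpow_le ht hq hF x)
  simp only [Pi.add_apply] at h
  rw [integral_add i1 i4, integral_const_mul, integral_sub i2 i3,
    integral_heatOp ht hg2] at h
  have hm := sq_integral_spow_le hq hF h0
  have hl : 0 ≤ 1 - Real.exp (-(8 * Real.pi ^ 2 * t)) := by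
    rw [sub_nonneg, Real.exp_le_one_iff]
    have : 0 < 8 * Real.pi ^ 2 * t := by positivity
    linarith
  have hm' := mul_le_mul_of_nonneg_left hm hl
  have hgap' := mul_le_mul_of_nonneg_left (hgap.trans (add_le_add_right hm' _)) hc0
  linarith

lemma integral_abs_heatOp_nat_rpow_le {s r : ℝ} (hs : 0 < s) (hq : 1 < q) (hr : 0 ≤ r)
    (hstep : ∀ F : UnitAddTorus (Fin d) → ℝ, MemLp F (ENNReal.ofReal q) → ∫ x, F x = 0 →
      ∫ x, |heatOp s F x| ^ q ≤ r * ∫ x, |F x| ^ q)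
    (hF : MemLp F (ENNReal.ofReal q)) (h0 : ∫ x, F x = 0) (n : ℕ) :
    ∫ x, |heatOp ((n + 1 : ℕ) * s) F x| ^ q ≤ r ^ (n + 1) * ∫ x, |F x| ^ q := by
  have hFi := integrable_of_memLp hq hF
  induction n with
  | zero => simpa using hstep F hF h0
  | succ n ih =>
    have hns : 0 < ((n + 1 : ℕ) : ℝ) * s := by positivity
    have he : ((n + 1 + 1 : ℕ) : ℝ) * s = s + ((n + 1 : ℕ) : ℝ) * s := by
      push_cast
      ring
    rw [he, ← heatOp_heatOp hs hns hFi, pow_succ' r (n + 1), mul_assoc]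
    exact (hstep _ (memLp_of_continuous (continuous_heatOp hns hFi) _)
      (by rw [integral_heatOp hns hFi, h0])).trans (mul_le_mul_of_nonneg_left ih hr)

lemma half_le_one_sub_exp_neg {x : ℝ} (h0 : 0 ≤ x) (h1 : x ≤ 1) : x / 2 ≤ 1 - Real.exp (-x) := by
  have h2 : Real.exp (-x) * (1 + x) ≤ 1 := by
    rw [Real.exp_neg, inv_mul_le_iff₀ (Real.exp_pos x), mul_one, add_comm]
    exact Real.add_one_le_exp x
  nlinarith [Real.exp_pos (-x)]

lemma integral_abs_heatOp_rpow_le_exp (ht : 0 < t) (hq : 1 < q)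
    (hF : MemLp F (ENNReal.ofReal q)) (h0 : ∫ x, F x = 0) :
    ∫ x, |heatOp t F x| ^ q ≤ Real.exp (-((q - 1) / q * t)) * ∫ x, |F x| ^ q := by
  obtain ⟨n, hn⟩ := exists_nat_gt (8 * Real.pi ^ 2 * t)
  set s := t / ((n + 1 : ℕ) : ℝ) with hs
  have hs0 : 0 < s := by positivity
  have hst : ((n + 1 : ℕ) : ℝ) * s = t := by
    rw [hs]
    field_simp
  set c := (q - 1) / q with hc
  have hc0 : 0 ≤ c := div_nonneg (by linarith) (by linarith)
  have hc1 : c ≤ 1 := by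
    rw [hc, div_le_one (by linarith)]
    linarith
  have hx1 : 8 * Real.pi ^ 2 * s ≤ 1 := by
    rw [hs, ← mul_div_assoc, div_le_one (by positivity)]
    push_cast
    linarith
  have hx := half_le_one_sub_exp_neg (x := 8 * Real.pi ^ 2 * s) (by positivity) hx1
  have hstep := integral_abs_heatOp_nat_rpow_le (r := Real.exp (-(c * s))) hs0 hq
    (Real.exp_pos _).le (fun G hG hG0 => (integral_abs_heatOp_rpow_le hs0 hq hG hG0).trans
      (mul_le_mul_of_nonneg_right ?_ (integral_nonneg fun x => by positivity))) hF h0 n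
  · rw [hst, ← Real.exp_nat_mul, mul_neg, mul_left_comm, hst] at hstep
    exact hstep
  · refine le_trans ?_ (Real.one_sub_le_exp_neg _)
    have hcq : (q - 1) / (2 * q) = c / 2 := by
      rw [hc]
      field_simp
    rw [hcq]
    have hpi : 9 * s ≤ Real.pi ^ 2 * s := by
      have := Real.pi_gt_three
      have : 9 ≤ Real.pi ^ 2 := by nlinarith
      gcongr
    have h4 : 36 * s ≤ 1 - Real.exp (-(8 * Real.pi ^ 2 * s)) := by linarith
    have h5 := mul_le_mul_of_nonneg_left h4 hc0
    have h6 := mul_nonneg hc0 hs0.le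
    linarith

lemma eLpNorm_heatOp_le (ht : 0 < t) (hq : 1 < q) (hF : MemLp F (ENNReal.ofReal q))
    (h0 : ∫ x, F x = 0) :
    eLpNorm (heatOp t F) (ENNReal.ofReal q) volume ≤
      ENNReal.ofReal (Real.exp (-((q - 1) / q ^ 2 * t))) *
        eLpNorm F (ENNReal.ofReal q) volume := by
  have hq0 : 0 < q := by linarith
  have hP : MemLp (heatOp t F) (ENNReal.ofReal q) :=
    memLp_of_continuous (continuous_heatOp ht (integrable_of_memLp hq hF)) _
  have hne : ENNReal.ofReal q ≠ 0 := by simpa using hq0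
  rw [hP.eLpNorm_eq_integral_rpow_norm hne ENNReal.ofReal_ne_top,
    hF.eLpNorm_eq_integral_rpow_norm hne ENNReal.ofReal_ne_top,
    ← ENNReal.ofReal_mul (Real.exp_pos _).le, ENNReal.toReal_ofReal hq0.le]
  refine ENNReal.ofReal_le_ofReal ?_
  simp_rw [Real.norm_eq_abs]
  have hE : Real.exp (-((q - 1) / q ^ 2 * t)) = Real.exp (-((q - 1) / q * t)) ^ q⁻¹ := by
    rw [← Real.exp_mul]
    congr 1
    field_simp
  rw [hE, ← Real.mul_rpow (Real.exp_pos _).le (integral_nonneg fun x => by positivity)]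
  exact Real.rpow_le_rpow (integral_nonneg fun x => by positivity)
    (integral_abs_heatOp_rpow_le_exp ht hq hF h0) (by positivity)

/-- The representative in `(0, 1]^d` of a point of the torus. -/
def torusRep (x : UnitAddTorus (Fin d)) : Fin d → ℝ :=
  (measurableEquivPiIoc (fun _ : Fin d => (0 : ℝ)) x).1

lemma coe_torusRep (x : UnitAddTorus (Fin d)) :
    (fun i => (torusRep x i : UnitAddCircle)) = x :=
  (measurableEquivPiIoc (fun _ : Fin d => (0 : ℝ))).symm_apply_apply x

lemma measurePreserving_torusRep :
    MeasurePreserving (torusRep (d := d)) volume (volume.restrict (cube d)) := by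
  have hset : MeasurableSet {x : Fin d → ℝ | ∀ i, x i ∈ Set.Ioc (0 : ℝ) (0 + 1)} :=
    MeasurableSet.univ_pi' fun _ => measurableSet_Ioc
  have h := (measurePreserving_subtype_coe (μa := (volume : Measure (Fin d → ℝ))) hset).comp
    (measurePreserving_equivPiIoc (fun _ : Fin d => (0 : ℝ)))
  have he : (volume : Measure (Fin d → ℝ)).restrict
      {x : Fin d → ℝ | ∀ i, x i ∈ Set.Ioc (0 : ℝ) (0 + 1)} = volume.restrict (cube d) := by
    refine Measure.restrict_congr_set ?_
    have := Measure.pi_Ioc_ae_eq_pi_Icc (μ := fun _ : Fin d => (volume : Measure ℝ))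
      (s := Set.univ) (f := fun _ => 0) (g := fun _ => 1)
    simpa [Set.pi, cube] using! this
  rw [he] at h
  exact h

lemma measurePreserving_torus_mk :
    MeasurePreserving (fun (x : Fin d → ℝ) (i : Fin d) => (x i : UnitAddCircle))
      (volume.restrict (cube d)) volume := by
  have hm : Measurable fun (x : Fin d → ℝ) (i : Fin d) => (x i : UnitAddCircle) :=
    measurable_pi_lambda _ fun i => AddCircle.measurable_mk'.comp (measurable_pi_apply i)
  refine ⟨hm, ?_⟩
  have h := measurePreserving_torusRep (d := d)
  rw [← h.map_eq, Measure.map_map hm h.measurable]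
  convert! Measure.map_id
  exact funext coe_torusRep

lemma setIntegral_kper2_eq (ht : 0 < t) {f : (Fin d → ℝ) → ℝ}
    (hf : AEStronglyMeasurable f (volume.restrict (cube d))) (x : Fin d → ℝ) :
    ∫ y in cube d, kper2 d t (x - y) * f y =
      heatOp t (f ∘ torusRep) fun i => (x i : UnitAddCircle) := by
  have h := measurePreserving_torusRep (d := d)
  have hk : Measurable (kper2 d t) := by
    rw [funext (kper2_eq t)]
    exact (continuous_heatKernel ht).measurable.comp measurePreserving_torus_mk.measurable
  rw [← h.map_eq, integral_map h.measurable.aemeasurable (by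
    rw [h.map_eq]
    exact (hk.comp (measurable_const.sub measurable_id)).aestronglyMeasurable.mul hf), heatOp]
  congr 1
  ext y
  rw [kper2_eq]
  congr 2
  ext i
  conv_rhs => rw [← coe_torusRep y]
  simp

/-- improved heat flow estimate in the periodic case for the Laplacian,
with an absolute constant c₂ > 0 (independent of the dimension). -/
theorem improved_heat_flow_periodic_laplacian :
    ∃ c₂ : ℝ, 0 < c₂ ∧
      ∀ d : ℕ, 1 ≤ d →
      ∀ q : ℝ, 1 < q →
      ∀ f : (Fin d → ℝ) → ℝ,
        (∀ (x : Fin d → ℝ) (n : Fin d → ℤ), f (x + fun i => (n i : ℝ)) = f x) →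
        LocallyIntegrable f volume →
        (∫ x in cube d, f x) = 0 →
        eLpNorm f (ENNReal.ofReal q) (volume.restrict (cube d)) < ⊤ →
      ∀ t : ℝ, 0 < t →
        eLpNorm (fun x => ∫ y in cube d, kper2 d t (x - y) * f y) (ENNReal.ofReal q)
            (volume.restrict (cube d)) ≤
          ENNReal.ofReal (Real.exp (-(c₂ * ((q - 1) / q ^ 2) * t))) *
            eLpNorm f (ENNReal.ofReal q) (volume.restrict (cube d)) := by
  refine ⟨1, one_pos, fun d _ q hq f _ hloc hmean hfin t ht => ?_⟩
  have hf : AEStronglyMeasurable f (volume.restrict (cube d)) :=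
    hloc.aestronglyMeasurable.restrict
  have hrep := measurePreserving_torusRep (d := d)
  have hmk := measurePreserving_torus_mk (d := d)
  have hF : MemLp (f ∘ torusRep) (ENNReal.ofReal q) :=
    MemLp.comp_measurePreserving ⟨hf, hfin⟩ hrep
  have hF0 : ∫ x, (f ∘ torusRep) x = 0 := by
    rw [← hmean, ← hrep.map_eq, integral_map hrep.measurable.aemeasurable
      (by rwa [hrep.map_eq])]
    rfl
  have h := eLpNorm_heatOp_le ht hq hF hF0
  rw [eLpNorm_comp_measurePreserving hf hrep] at h
  simp_rw [setIntegral_kper2_eq ht hf]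
  have hc := continuous_heatOp ht (integrable_of_memLp hq hF)
  rw [one_mul, ← Function.comp_def (heatOp t (f ∘ torusRep)),
    eLpNorm_comp_measurePreserving hc.aestronglyMeasurable hmk]
  exact h

end
end
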